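/- arXiv:1305.1098 — 2 statements merged into one kernel-verified Lean document; each statement's English description precedes it below -/
import Mathlib

section
/- Let T be a d-angulation of a convex n-gon with vertices labelled 1,…,n counterclockwise, where n = d + m(d−2), d ≥ 3, m ≥ 0. For vertices i, j, let m_{i,j} denote the number of counterclockwise d-paths from i to j. Then m_{i,j} = m_{j,i} for all i, j; that is, the matrix M_T = (m_{i,j}) is symmetric. -/
noncomputable section

/-- The `k`-th vertex of a regular `n`-gon inscribed in the unit circle. -/
def vtx (n : ℕ) (k : ZMod n) : ℝ × ℝ :=
  (Real.cos (2 * Real.pi * k.val / n), Real.sin (2 * Real.pi * k.val / n))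

/-- The convex hull spanned by a set `c` of vertices of the `n`-gon. -/
def cellHull (n : ℕ) (c : Finset (ZMod n)) : Set (ℝ × ℝ) :=
  convexHull ℝ (vtx n '' (c : Set (ZMod n)))

/-- `T` is a `d`-angulation of the convex `n`-gon: a dissection of the polygon by
pairwise non-crossing diagonals into `d`-gon cells.  Each cell is recorded by its
vertex set; the cells cover the polygon and have pairwise disjoint interiors. -/
def IsDAngulation (n d : ℕ) (T : Finset (Finset (ZMod n))) : Prop :=
  (∀ c ∈ T, c.card = d) ∧
  (⋃ c ∈ T, cellHull n c) = convexHull ℝ (Set.range (vtx n)) ∧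
  ∀ c ∈ T, ∀ c' ∈ T, c ≠ c' →
    interior (cellHull n c) ∩ interior (cellHull n c') = ∅

/-- The number of vertices strictly between `i` and `j`, going counterclockwise. -/
def pathLen (n : ℕ) (i j : ZMod n) : ℕ := (j - i - 1).val

/-- A (counterclockwise) `d`-path from `i` to `j` in the `d`-angulation `T`:
a sequence `p_{i+1}, …, p_{j-1}` of cells of `T`, indexed by the vertices
encountered going counterclockwise from `i` to `j`, such that the cell at
position `k` is incident to the vertex `i+1+k`, and each cell of `T` occurs
at most `d - 2` times in the sequence. -/
def IsDPath (n d : ℕ) (T : Finset (Finset (ZMod n))) (i j : ZMod n)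
    (q : Fin (pathLen n i j) → {c // c ∈ T}) : Prop :=
  (∀ k, (i + 1 + ((k : ℕ) : ZMod n)) ∈ (q k : Finset (ZMod n))) ∧
  ∀ c ∈ T, (Finset.univ.filter (fun k => (q k : Finset (ZMod n)) = c)).card ≤ d - 2

/-- The number `m_{i,j}` of counterclockwise `d`-paths from `i` to `j`. -/
def dPathCount (n d : ℕ) (T : Finset (Finset (ZMod n))) (i j : ZMod n) : ℕ :=
  Nat.card {q : Fin (pathLen n i j) → {c // c ∈ T} // IsDPath n d T i j q}

section Combinatorics

variable {α : Type*} [LinearOrder α]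

/-- The polygons with vertex set `V` and dissection `T` that arise from a two-gon by repeatedly
gluing a cell with `e` new vertices onto a side. -/
inductive IsGlued (e : ℕ) : Finset α → Finset (Finset α) → Prop
  | base {a b : α} (hab : a < b) : IsGlued e {a, b} ∅
  | glue {V : Finset α} {T : Finset (Finset α)} {a b : α} {E : Finset α} (h : IsGlued e V T)
      (ha : a ∈ V) (hb : b ∈ V) (hab : a < b) (hV : ∀ x ∈ V, x ≤ a ∨ b ≤ x)
      (hE : ∀ x ∈ E, a < x ∧ x < b) (hcard : E.card = e) :
      IsGlued e (V ∪ E) (insert (insert a (insert b E)) T)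

theorem IsGlued.subset {e : ℕ} {V : Finset α} {T : Finset (Finset α)} (h : IsGlued e V T) :
    ∀ c ∈ T, c ⊆ V := by
  induction h with
  | base hab => simp
  | @glue V T a b E h ha hb hab hV hE hcard ih =>
    intro c hc
    rcases Finset.mem_insert.1 hc with rfl | hc
    · intro x hx
      simp only [Finset.mem_insert] at hx
      rcases hx with rfl | rfl | hx
      · exact Finset.mem_union_left _ ha
      · exact Finset.mem_union_left _ hb
      · exact Finset.mem_union_right _ hx
    · exact (ih c hc).trans Finset.subset_union_left

theorem disjoint_of_gap {V E : Finset α} {a b : α} (hV : ∀ x ∈ V, x ≤ a ∨ b ≤ x)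
    (hE : ∀ x ∈ E, a < x ∧ x < b) : Disjoint V E := by
  refine Finset.disjoint_left.2 fun x hx hxE => ?_
  have := hE x hxE
  rcases hV x hx with h | h
  · exact absurd this.1 h.not_gt
  · exact absurd this.2 h.not_gt

theorem IsGlued.card_eq {e : ℕ} (he : 0 < e) {V : Finset α} {T : Finset (Finset α)}
    (h : IsGlued e V T) : V.card = e * T.card + 2 := by
  induction h with
  | base hab => simp [Finset.card_pair hab.ne]
  | @glue V T a b E h ha hb hab hV hE hcard ih =>
    have hVE := disjoint_of_gap hV hE
    have hc : insert a (insert b E) ∉ T := by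
      intro hmem
      obtain ⟨x, hx⟩ := Finset.card_pos.1 (hcard ▸ he)
      exact Finset.disjoint_left.1 hVE (h.subset _ hmem (by simp [hx])) hx
    rw [Finset.card_union_of_disjoint hVE, Finset.card_insert_of_notMem hc, ih, hcard]
    ring

/-- A cell that does not cross a cell `c` spanning `[a, b]` lies between two consecutive vertices
of `c`. -/
theorem exists_gap_of_noncrossing {c c' : Finset α} {a b : α} (hac : a ∈ c) (hbc : b ∈ c)
    (hcc' : c ≠ c') (hcard : c.card = c'.card) (hc' : 3 ≤ c'.card)
    (hcsub : ∀ x ∈ c, a ≤ x ∧ x ≤ b) (hsub : ∀ x ∈ c', a ≤ x ∧ x ≤ b)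
    (h₁ : ∀ x u y v, x < u → u < y → y < v → x ∈ c → y ∈ c → u ∈ c' → v ∈ c' → False)
    (h₂ : ∀ x u y v, x < u → u < y → y < v → x ∈ c' → y ∈ c' → u ∈ c → v ∈ c → False) :
    ∃ u ∈ c, ∃ v ∈ c, u < v ∧ (∀ x ∈ c, x ≤ u ∨ v ≤ x) ∧ ∀ x ∈ c', u ≤ x ∧ x ≤ v := by
  have hne : c'.Nonempty := Finset.card_pos.1 (by omega)
  obtain ⟨p, hp, hpmin⟩ : ∃ p ∈ c', ∀ x ∈ c', p ≤ x :=
    ⟨_, Finset.min'_mem c' hne, fun x hx => Finset.min'_le _ _ hx⟩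
  obtain ⟨q, hq, hqmax⟩ : ∃ q ∈ c', ∀ x ∈ c', x ≤ q :=
    ⟨_, Finset.max'_mem c' hne, fun x hx => Finset.le_max' _ _ hx⟩
  have hpq : p < q := by
    obtain ⟨x, hx, y, hy, hxy⟩ := Finset.one_lt_card.1 (by omega : 1 < c'.card)
    have := hpmin x hx; have := hpmin y hy; have := hqmax x hx; have := hqmax y hy
    grind
  have hbetween : ∀ w ∈ c, ¬ (p < w ∧ w < q) := by
    rintro w hw ⟨hpw, hwq⟩
    rcases (hsub p hp).1.lt_or_eq with hap | rfl
    · exact h₁ a p w q hap hpw hwq hac hw hp hq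
    rcases (hsub q hq).2.lt_or_eq with hqb | rfl
    · exact h₂ a w q b hpw hwq hqb hp hq hw hbc
    obtain ⟨w', hw', hw'c⟩ : ∃ w' ∈ c, w' ∉ c' := by
      by_contra! hcon
      exact hcc' (Finset.eq_of_subset_of_card_le hcon hcard.ge)
    obtain ⟨z, hz, hzab⟩ := Finset.exists_mem_notMem_of_card_lt_card
      (lt_of_le_of_lt (Finset.card_le_two (a := a) (b := q)) (by omega : 2 < c'.card))
    simp only [Finset.mem_insert, Finset.mem_singleton, not_or] at hzab
    have h3 := hsub z hz
    have h4 := hcsub w' hw'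
    rcases lt_trichotomy z w' with h | h | h
    · exact h₁ a z w' q (by grind) h (by grind) hac hw' hz hq
    · exact hw'c (h ▸ hz)
    · exact h₂ a w' z q (by grind) h (by grind) hp hz hw' hbc
  have hlow : (c.filter (· ≤ p)).Nonempty := ⟨a, by simp [hac, (hsub p hp).1]⟩
  have hupp : (c.filter (q ≤ ·)).Nonempty := ⟨b, by simp [hbc, (hsub q hq).2]⟩
  obtain ⟨u, hu, humax⟩ : ∃ u ∈ c.filter (· ≤ p), ∀ x ∈ c.filter (· ≤ p), x ≤ u :=
    ⟨_, Finset.max'_mem _ hlow, fun x hx => Finset.le_max' _ _ hx⟩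
  obtain ⟨v, hv, hvmin⟩ : ∃ v ∈ c.filter (q ≤ ·), ∀ x ∈ c.filter (q ≤ ·), v ≤ x :=
    ⟨_, Finset.min'_mem _ hupp, fun x hx => Finset.min'_le _ _ hx⟩
  simp only [Finset.mem_filter] at hu humax hv hvmin
  refine ⟨u, hu.1, v, hv.1, hu.2.trans_lt (hpq.trans_le hv.2), fun x hx => ?_, fun x hx =>
    ⟨hu.2.trans (hpmin x hx), (hqmax x hx).trans hv.2⟩⟩
  have := hbetween x hx
  by_cases hxp : x ≤ p
  · exact Or.inl (humax x ⟨hx, hxp⟩)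
  · exact Or.inr (hvmin x ⟨hx, by grind⟩)

variable [Fintype α]

/-- The ways of choosing, for each vertex of `S`, an incident cell of `T`, using no cell more than
`e` times; a choice is extended by `∅` outside `S`. -/
def cellChoices (e : ℕ) (T : Finset (Finset α)) (S : Finset α) : Finset (α → Finset α) :=
  {f | (∀ x ∈ S, f x ∈ T ∧ x ∈ f x) ∧ (∀ x ∉ S, f x = ∅) ∧
    ∀ c ∈ T, (S.filter fun x => f x = c).card ≤ e}

theorem mem_cellChoices {e : ℕ} {T : Finset (Finset α)} {S : Finset α} {f : α → Finset α} :
    f ∈ cellChoices e T S ↔ (∀ x ∈ S, f x ∈ T ∧ x ∈ f x) ∧ (∀ x ∉ S, f x = ∅) ∧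
      ∀ c ∈ T, (S.filter fun x => f x = c).card ≤ e := by
  simp [cellChoices]

theorem card_cellChoices_empty (e : ℕ) (T : Finset (Finset α)) :
    (cellChoices e T ∅).card = 1 := by
  rw [Finset.card_eq_one]
  refine ⟨fun _ => ∅, ?_⟩
  ext f
  simp [mem_cellChoices, funext_iff]

theorem cellChoices_eq_empty_of_notMem {e : ℕ} {T : Finset (Finset α)} {S : Finset α} {x : α}
    (hx : x ∈ S) (h : ∀ c ∈ T, x ∉ c) : cellChoices e T S = ∅ := by
  rw [Finset.eq_empty_iff_forall_notMem]
  intro f hf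
  obtain ⟨h1, h2⟩ := (mem_cellChoices.1 hf).1 x hx
  exact h _ h1 h2

theorem cellChoices_eq_empty_of_card_lt {e : ℕ} {T : Finset (Finset α)} {S : Finset α}
    (h : e * T.card < S.card) : cellChoices e T S = ∅ := by
  rw [Finset.eq_empty_iff_forall_notMem]
  intro f hf
  obtain ⟨h1, -, h3⟩ := mem_cellChoices.1 hf
  have := Finset.card_le_mul_card_image_of_maps_to (fun x hx => (h1 x hx).1) e h3
  omega

/-- Splitting off the set `B` of vertices that choose a given cell `c`. -/
theorem card_cellChoices_insert (e : ℕ) {T : Finset (Finset α)} {c : Finset α} (hc : c ∉ T)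
    (S : Finset α) :
    (cellChoices e (insert c T) S).card =
      ∑ B ∈ (S ∩ c).powerset with B.card ≤ e, (cellChoices e T (S \ B)).card := by
  rw [Finset.card_eq_sum_card_fiberwise (f := fun f => S.filter fun x => f x = c)
    (t := {B ∈ (S ∩ c).powerset | B.card ≤ e})]
  · refine Finset.sum_congr rfl fun B hB => ?_
    simp only [Finset.mem_filter, Finset.mem_powerset, Finset.subset_inter_iff] at hB
    obtain ⟨⟨hBS, hBc⟩, hBe⟩ := hB
    refine Finset.card_nbij' (fun f x => if x ∈ B then ∅ else f x)
      (fun f x => if x ∈ B then c else f x) ?_ ?_ ?_ ?_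
    · intro f hf
      simp only [Finset.coe_filter, Set.mem_ofPred_eq, mem_cellChoices] at hf
      obtain ⟨⟨h1, h2, h3⟩, h4⟩ := hf
      have h5 : ∀ x, x ∈ B ↔ x ∈ S ∧ f x = c := fun x => by rw [← h4]; simp
      refine Finset.mem_coe.2 (mem_cellChoices.2 ⟨?_, ?_, ?_⟩)
      · intro x hx
        have := h1 x
        have := h5 x
        simp only [Finset.mem_sdiff, Finset.mem_insert] at *
        simp only [hx.2, if_false]
        tauto
      · intro x hx
        by_cases hxB : x ∈ B
        · simp [hxB]
        · simp only [hxB, if_false]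
          exact h2 x fun hxS => hx (Finset.mem_sdiff.2 ⟨hxS, hxB⟩)
      · intro c' hc'
        refine le_trans (Finset.card_le_card ?_) (h3 c' (Finset.mem_insert_of_mem hc'))
        intro x
        simp only [Finset.mem_filter, Finset.mem_sdiff]
        rintro ⟨⟨hxS, hxB⟩, hx⟩
        exact ⟨hxS, by simpa [hxB] using hx⟩
    · intro f hf
      obtain ⟨h1, h2, h3⟩ := mem_cellChoices.1 (Finset.mem_coe.1 hf)
      have key : ∀ x ∈ S, (if x ∈ B then c else f x) = c ↔ x ∈ B := by
        intro x hx
        by_cases hxB : x ∈ B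
        · simp [hxB]
        · simp only [hxB, if_false, iff_false]
          intro h
          exact hc (h ▸ (h1 x (Finset.mem_sdiff.2 ⟨hx, hxB⟩)).1)
      have hfil : (S.filter fun x => (if x ∈ B then c else f x) = c) = B := by
        ext x
        simp only [Finset.mem_filter]
        exact ⟨fun h => (key x h.1).1 h.2, fun h => ⟨hBS h, (key x (hBS h)).2 h⟩⟩
      simp only [Finset.coe_filter, Set.mem_ofPred_eq, mem_cellChoices]
      refine ⟨⟨?_, ?_, ?_⟩, hfil⟩
      · intro x hx
        by_cases hxB : x ∈ B
        · simp [hxB, hBc hxB]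
        · have := h1 x (Finset.mem_sdiff.2 ⟨hx, hxB⟩)
          simp [hxB, this]
      · intro x hx
        have hxB : x ∉ B := fun h => hx (hBS h)
        simp only [hxB, if_false]
        exact h2 x fun h => hx (Finset.mem_sdiff.1 h).1
      · intro c' hc'
        rcases Finset.mem_insert.1 hc' with rfl | hc'
        · rw [hfil]; exact hBe
        · refine le_trans (Finset.card_le_card ?_) (h3 c' hc')
          intro x
          simp only [Finset.mem_filter, Finset.mem_sdiff]
          rintro ⟨hxS, hx⟩
          by_cases hxB : x ∈ B
          · simp only [hxB, if_true] at hx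
            exact absurd (hx ▸ hc') hc
          · exact ⟨⟨hxS, hxB⟩, by simpa [hxB] using hx⟩
    · intro f hf
      simp only [Finset.coe_filter, Set.mem_ofPred_eq] at hf
      funext x
      by_cases hxB : x ∈ B
      · have : f x = c := by rw [← hf.2] at hxB; exact (Finset.mem_filter.1 hxB).2
        simp [hxB, this]
      · simp [hxB]
    · intro f hf
      obtain ⟨-, h2, -⟩ := mem_cellChoices.1 (Finset.mem_coe.1 hf)
      funext x
      by_cases hxB : x ∈ B
      · simp [hxB, h2 x fun h => (Finset.mem_sdiff.1 h).2 hxB]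
      · simp [hxB]
  · intro f hf
    obtain ⟨h1, -, h3⟩ := mem_cellChoices.1 (Finset.mem_coe.1 hf)
    simp only [Finset.coe_filter, Set.mem_ofPred_eq, Finset.mem_powerset]
    refine ⟨?_, h3 c (Finset.mem_insert_self _ _)⟩
    intro x hx
    obtain ⟨hxS, hxc⟩ := Finset.mem_filter.1 hx
    exact Finset.mem_inter.2 ⟨hxS, hxc ▸ (h1 x hxS).2⟩

/-- The new vertices of a glued cell have to choose that cell. -/
theorem card_cellChoices_glue {e : ℕ} {V : Finset α} {T : Finset (Finset α)} {a b : α}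
    {E F S : Finset α} (hT : ∀ c ∈ T, c ⊆ V) (hVE : Disjoint V E)
    (hE : E.Nonempty) (hF : F ⊆ E) (hS : S ⊆ V) :
    (cellChoices e (insert (insert a (insert b E)) T) (F ∪ S)).card =
      ∑ B ∈ (S ∩ {a, b}).powerset with F.card + B.card ≤ e, (cellChoices e T (S \ B)).card := by
  have hdisj : ∀ x ∈ V, x ∉ E := fun x hx hxE => Finset.disjoint_left.1 hVE hx hxE
  have hc : insert a (insert b E) ∉ T := by
    intro h
    obtain ⟨x, hx⟩ := hE
    exact hdisj x (hT _ h (by simp [hx])) hx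
  have hsub : ∀ {B}, B ⊆ S ∩ {a, b} → Disjoint F B := fun {B} hB =>
    Finset.disjoint_left.2 fun x hxF hxB =>
      hdisj x (hS (Finset.mem_inter.1 (hB hxB)).1) (hF hxF)
  rw [card_cellChoices_insert e hc]
  symm
  refine Finset.sum_of_injOn (fun B => F ∪ B) ?_ ?_ ?_ ?_
  · intro B hB C hC h
    simp only [Finset.coe_filter, Set.mem_ofPred_eq, Finset.mem_powerset] at hB hC
    have h' : F ∪ B = F ∪ C := h
    rw [← Finset.union_sdiff_cancel_left (hsub hB.1), h',
      Finset.union_sdiff_cancel_left (hsub hC.1)]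
  · intro B hB
    simp only [Finset.coe_filter, Set.mem_ofPred_eq, Finset.mem_powerset] at hB ⊢
    refine ⟨?_, by rw [Finset.card_union_of_disjoint (hsub hB.1)]; exact hB.2⟩
    intro x hx
    rcases Finset.mem_union.1 hx with hx | hx
    · simp [hx, hF hx]
    · have := hB.1 hx
      simp only [Finset.mem_inter, Finset.mem_insert, Finset.mem_singleton, Finset.mem_union] at *
      tauto
  · intro C hC hCF
    simp only [Finset.mem_filter, Finset.mem_powerset] at hC
    by_cases hFC : F ⊆ C
    · refine absurd ⟨C \ F, ?_, Finset.union_sdiff_of_subset hFC⟩ hCF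
      simp only [Finset.coe_filter, Set.mem_ofPred_eq, Finset.mem_powerset]
      refine ⟨?_, ?_⟩
      · intro x hx
        obtain ⟨hxC, hxF⟩ := Finset.mem_sdiff.1 hx
        have h1 := hC.1 hxC
        have h2 := hdisj x
        have h3 := @hS x
        simp only [Finset.mem_inter, Finset.mem_insert, Finset.mem_singleton,
          Finset.mem_union] at *
        tauto
      · have := Finset.card_sdiff_add_card_eq_card hFC
        omega
    · obtain ⟨x, hxF, hxC⟩ := Finset.not_subset.1 hFC
      rw [cellChoices_eq_empty_of_notMem (x := x), Finset.card_empty]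
      · simp [hxF, hxC]
      · exact fun c hc hxc => hdisj x (hT c hc hxc) (hF hxF)
  · intro B hB
    simp only [Finset.mem_filter, Finset.mem_powerset] at hB
    congr 2
    ext x
    have h2 := hdisj x
    have h3 := @hS x
    have h4 := @hF x
    simp only [Finset.mem_sdiff, Finset.mem_union] at *
    tauto

theorem card_cellChoices_glue_full {e : ℕ} {V : Finset α} {T : Finset (Finset α)} {a b : α}
    {E S : Finset α} (hT : ∀ c ∈ T, c ⊆ V) (hVE : Disjoint V E)
    (hE : E.Nonempty) (hcard : E.card = e) (hS : S ⊆ V) :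
    (cellChoices e (insert (insert a (insert b E)) T) (E ∪ S)).card =
      (cellChoices e T S).card := by
  rw [card_cellChoices_glue hT hVE hE subset_rfl hS]
  rw [show ({B ∈ (S ∩ {a, b}).powerset | E.card + B.card ≤ e}) = {∅} by
    ext B
    simp only [Finset.mem_filter, Finset.mem_powerset, Finset.mem_singleton, hcard,
      add_le_iff_nonpos_right, nonpos_iff_eq_zero, Finset.card_eq_zero, and_iff_right_iff_imp]
    rintro rfl
    simp]
  simp

theorem card_cellChoices_glue_of_notMem {e : ℕ} {V : Finset α} {T : Finset (Finset α)} {a b : α}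
    {E F S : Finset α} (hT : ∀ c ∈ T, c ⊆ V) (hVE : Disjoint V E)
    (hE : E.Nonempty) (hcard : E.card = e) (hF : F ⊆ E) (hS : S ⊆ V) (haS : a ∉ S)
    (hbS : b ∉ S) :
    (cellChoices e (insert (insert a (insert b E)) T) (F ∪ S)).card =
      (cellChoices e T S).card := by
  have h0 : S ∩ {a, b} = ∅ := by
    ext x
    simp only [Finset.mem_inter, Finset.mem_insert, Finset.mem_singleton, Finset.notMem_empty,
      iff_false]
    rintro ⟨h, rfl | rfl⟩ <;> contradiction
  have := Finset.card_le_card hF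
  rw [card_cellChoices_glue hT hVE hE hF hS, h0, Finset.powerset_empty,
    Finset.filter_singleton, Finset.card_empty, if_pos (by omega)]
  simp

theorem card_cellChoices_glue_right {e : ℕ} {V : Finset α} {T : Finset (Finset α)} {a b : α}
    {E F S : Finset α} (hT : ∀ c ∈ T, c ⊆ V) (hVE : Disjoint V E)
    (hE : E.Nonempty) (hF : F ⊆ E) (hFe : F.card < e) (hS : S ⊆ V) (haS : a ∉ S)
    (hbS : b ∈ S) :
    (cellChoices e (insert (insert a (insert b E)) T) (F ∪ S)).card =
      (cellChoices e T S).card + (cellChoices e T (S.erase b)).card := by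
  have h0 : S ∩ {a, b} = insert b ∅ := by
    ext x
    simp only [Finset.mem_inter, Finset.mem_insert, Finset.mem_singleton, Finset.notMem_empty,
      or_false]
    constructor
    · rintro ⟨h, rfl | rfl⟩ <;> [contradiction; rfl]
    · rintro rfl
      exact ⟨hbS, Or.inr rfl⟩
  rw [card_cellChoices_glue hT hVE hE hF hS, Finset.sum_filter, h0,
    Finset.sum_powerset_insert (Finset.notMem_empty b)]
  simp [hFe.le, Finset.sdiff_singleton_eq_erase, Nat.succ_le_iff.2 hFe]

theorem card_cellChoices_glue_left {e : ℕ} {V : Finset α} {T : Finset (Finset α)} {a b : α}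
    {E F S : Finset α} (hT : ∀ c ∈ T, c ⊆ V) (hVE : Disjoint V E)
    (hE : E.Nonempty) (hF : F ⊆ E) (hFe : F.card < e) (hS : S ⊆ V) (haS : a ∈ S)
    (hbS : b ∉ S) :
    (cellChoices e (insert (insert a (insert b E)) T) (F ∪ S)).card =
      (cellChoices e T S).card + (cellChoices e T (S.erase a)).card := by
  rw [Finset.insert_comm]
  exact card_cellChoices_glue_right hT hVE hE hF hFe hS hbS haS

theorem card_cellChoices_glue_both {e : ℕ} {V : Finset α} {T : Finset (Finset α)} {a b : α}
    {E F S : Finset α} (hT : ∀ c ∈ T, c ⊆ V) (hVE : Disjoint V E)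
    (hE : E.Nonempty) (hF : F ⊆ E) (hFe : F.card + 2 ≤ e) (hS : S ⊆ V) (haS : a ∈ S)
    (hbS : b ∈ S) (hab : a ≠ b) :
    (cellChoices e (insert (insert a (insert b E)) T) (F ∪ S)).card =
      (cellChoices e T S).card + (cellChoices e T (S.erase b)).card +
        ((cellChoices e T (S.erase a)).card + (cellChoices e T ((S.erase a).erase b)).card) := by
  have h0 : S ∩ {a, b} = insert a (insert b ∅) := by
    ext x
    simp only [Finset.mem_inter, Finset.mem_insert, Finset.mem_singleton, Finset.notMem_empty,
      or_false, and_iff_right_iff_imp]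
    rintro (rfl | rfl) <;> assumption
  rw [card_cellChoices_glue hT hVE hE hF hS, Finset.sum_filter, h0,
    Finset.sum_powerset_insert (by simpa using hab),
    Finset.sum_powerset_insert (Finset.notMem_empty b),
    Finset.sum_powerset_insert (Finset.notMem_empty b)]
  have h1 : F.card + 1 ≤ e := by omega
  have h2 : F.card ≤ e := by omega
  have h3 : S \ {a, b} = (S.erase a).erase b := by
    ext x
    simp only [Finset.mem_sdiff, Finset.mem_insert, Finset.mem_singleton, Finset.mem_erase]
    tauto
  simp [hFe, h1, h2, h3, Finset.card_pair hab, Finset.sdiff_singleton_eq_erase]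

set_option maxHeartbeats 1000000 in
/-- Two vertices split a glued polygon into two sides, which have equally many choices. -/
theorem IsGlued.card_cellChoices_eq {e : ℕ} (he : 0 < e) {V : Finset α} {T : Finset (Finset α)}
    (h : IsGlued e V T) {i j : α} (hi : i ∈ V) (hj : j ∈ V) (hij : i < j) :
    (cellChoices e T {x ∈ V | i < x ∧ x < j}).card =
      (cellChoices e T {x ∈ V | x < i ∨ j < x}).card := by
  induction h generalizing i j with
  | @base a b hab =>
    have h1 : ({x ∈ ({a, b} : Finset α) | i < x ∧ x < j}) = ∅ := by
      ext x; simp only [Finset.mem_insert, Finset.mem_singleton, Finset.mem_filter] at *; grind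
    have h2 : ({x ∈ ({a, b} : Finset α) | x < i ∨ j < x}) = ∅ := by
      ext x; simp only [Finset.mem_insert, Finset.mem_singleton, Finset.mem_filter] at *; grind
    rw [h1, h2]
  | @glue V T a b E h ha hb hab hV hE hcard ih =>
    have hVE := disjoint_of_gap hV hE
    have hT := h.subset
    have hEne : E.Nonempty := Finset.card_pos.1 (hcard ▸ he)
    have hVcard := h.card_eq he
    have hfull : cellChoices e T V = ∅ := cellChoices_eq_empty_of_card_lt (by omega)
    have hone : ∀ x ∈ V, cellChoices e T (V.erase x) = ∅ := fun x hx =>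
      cellChoices_eq_empty_of_card_lt (by rw [Finset.card_erase_of_mem hx]; omega)
    have hpair : (cellChoices e T ((V.erase a).erase b)).card = 1 := by
      have := ih ha hb hab
      rw [show ({x ∈ V | a < x ∧ x < b}) = ∅ by
          ext x; simp only [Finset.mem_filter, Finset.notMem_empty, iff_false]; grind,
        show ({x ∈ V | x < a ∨ b < x}) = (V.erase a).erase b by
          ext x; simp only [Finset.mem_filter, Finset.mem_erase]; grind,
        card_cellChoices_empty] at this
      exact this.symm
    have split : ∀ p : α → Prop, ∀ [DecidablePred p],
        (V ∪ E).filter p = E.filter p ∪ V.filter p := by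
      intro p _; rw [Finset.filter_union, Finset.union_comm]
    have hFcard : ∀ (p : α → Prop) [DecidablePred p], ∀ x ∈ E, ¬ p x → (E.filter p).card < e := by
      intro p _ x hx hp
      rw [← hcard]
      exact Finset.card_lt_card (Finset.filter_ssubset.2 ⟨x, hx, hp⟩)
    have gfull : ∀ (p : α → Prop) [DecidablePred p], (∀ x ∈ E, p x) →
        (cellChoices e (insert (insert a (insert b E)) T) (E.filter p ∪ V.filter p)).card =
          (cellChoices e T (V.filter p)).card := by
      intro p _ hp
      rw [Finset.filter_true_of_mem hp]
      exact card_cellChoices_glue_full hT hVE hEne hcard (Finset.filter_subset _ _)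
    have gnone : ∀ (p : α → Prop) [DecidablePred p], ¬ p a → ¬ p b →
        (cellChoices e (insert (insert a (insert b E)) T) (E.filter p ∪ V.filter p)).card =
          (cellChoices e T (V.filter p)).card := by
      intro p _ hpa hpb
      exact card_cellChoices_glue_of_notMem hT hVE hEne hcard (Finset.filter_subset _ _)
        (Finset.filter_subset _ _) (by simp [hpa]) (by simp [hpb])
    have gright : ∀ (p : α → Prop) [DecidablePred p], ∀ x ∈ E, ¬ p x → ¬ p a → p b →
        (cellChoices e (insert (insert a (insert b E)) T) (E.filter p ∪ V.filter p)).card =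
          (cellChoices e T (V.filter p)).card +
            (cellChoices e T ((V.filter p).erase b)).card := by
      intro p _ x hx hpx hpa hpb
      exact card_cellChoices_glue_right hT hVE hEne (Finset.filter_subset _ _)
        (hFcard p x hx hpx) (Finset.filter_subset _ _) (by simp [hpa]) (by simp [hpb, hb])
    have gleft : ∀ (p : α → Prop) [DecidablePred p], ∀ x ∈ E, ¬ p x → p a → ¬ p b →
        (cellChoices e (insert (insert a (insert b E)) T) (E.filter p ∪ V.filter p)).card =
          (cellChoices e T (V.filter p)).card +
            (cellChoices e T ((V.filter p).erase a)).card := by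
      intro p _ x hx hpx hpa hpb
      exact card_cellChoices_glue_left hT hVE hEne (Finset.filter_subset _ _)
        (hFcard p x hx hpx) (Finset.filter_subset _ _) (by simp [hpa, ha]) (by simp [hpb])
    rw [split, split]
    rcases Finset.mem_union.1 hi with hiV | hiE
    · rcases Finset.mem_union.1 hj with hjV | hjE
      · rcases hV i hiV with hia | hbi
        · rcases hV j hjV with hja | hbj
          · rw [gnone _ (by grind) (by grind), gfull _ (by grind), ih hiV hjV hij]
          · rw [gfull _ (by grind), gnone _ (by grind) (by grind), ih hiV hjV hij]
        · rw [gnone _ (by grind) (by grind), gfull _ (by grind), ih hiV hjV hij]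
      · have hia : i ≤ a := by grind
        obtain ⟨haj, hjb⟩ := hE j hjE
        rw [gright (fun x => x < i ∨ j < x) j hjE (by grind) (by grind) (by grind)]
        rcases hia.lt_or_eq with hia | rfl
        · rw [gleft (fun x => i < x ∧ x < j) j hjE (by grind) (by grind) (by grind),
            show V.filter (fun x => i < x ∧ x < j) = V.filter fun x => i < x ∧ x < b by
              ext x; simp only [Finset.mem_filter]; grind,
            show (V.filter fun x => i < x ∧ x < b).erase a = V.filter fun x => i < x ∧ x < a by
              ext x; simp only [Finset.mem_filter, Finset.mem_erase]; grind,
            show V.filter (fun x => x < i ∨ j < x) = V.filter fun x => x < i ∨ a < x by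
              ext x; simp only [Finset.mem_filter]; grind,
            show (V.filter fun x => x < i ∨ a < x).erase b = V.filter fun x => x < i ∨ b < x by
              ext x; simp only [Finset.mem_filter, Finset.mem_erase]; grind,
            ih hiV hb (hia.trans hab), ih hiV ha hia, add_comm]
        · rw [gnone (fun x => i < x ∧ x < j) (by grind) (by grind),
            show V.filter (fun x => i < x ∧ x < j) = ∅ by
              ext x; simp only [Finset.mem_filter, Finset.notMem_empty, iff_false]; grind,
            show V.filter (fun x => x < i ∨ j < x) = V.erase i by
              ext x; simp only [Finset.mem_filter, Finset.mem_erase]; grind,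
            hone i ha, hpair, card_cellChoices_empty, Finset.card_empty]
    · obtain ⟨hai, hib⟩ := hE i hiE
      rcases Finset.mem_union.1 hj with hjV | hjE
      · have hbj : b ≤ j := by grind
        rw [gleft (fun x => x < i ∨ j < x) i hiE (by grind) (by grind) (by grind)]
        rcases hbj.lt_or_eq with hbj | rfl
        · rw [gright (fun x => i < x ∧ x < j) i hiE (by grind) (by grind) (by grind),
            show V.filter (fun x => i < x ∧ x < j) = V.filter fun x => a < x ∧ x < j by
              ext x; simp only [Finset.mem_filter]; grind,
            show (V.filter fun x => a < x ∧ x < j).erase b = V.filter fun x => b < x ∧ x < j by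
              ext x; simp only [Finset.mem_filter, Finset.mem_erase]; grind,
            show V.filter (fun x => x < i ∨ j < x) = V.filter fun x => x < b ∨ j < x by
              ext x; simp only [Finset.mem_filter]; grind,
            show (V.filter fun x => x < b ∨ j < x).erase a = V.filter fun x => x < a ∨ j < x by
              ext x; simp only [Finset.mem_filter, Finset.mem_erase]; grind,
            ih ha hjV (hab.trans hbj), ih hb hjV hbj, add_comm]
        · rw [gnone (fun x => i < x ∧ x < b) (by grind) (by grind),
            show V.filter (fun x => i < x ∧ x < b) = ∅ by
              ext x; simp only [Finset.mem_filter, Finset.notMem_empty, iff_false]; grind,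
            show V.filter (fun x => x < i ∨ b < x) = V.erase b by
              ext x; simp only [Finset.mem_filter, Finset.mem_erase]; grind,
            hone b hb, Finset.erase_right_comm, hpair, card_cellChoices_empty, Finset.card_empty]
      · obtain ⟨haj, hjb⟩ := hE j hjE
        have hF : (E.filter fun x => x < i ∨ j < x).card + 2 ≤ e := by
          rw [← hcard, ← Finset.card_pair hij.ne, ← Finset.card_union_of_disjoint]
          · refine Finset.card_le_card fun x => ?_
            simp only [Finset.mem_union, Finset.mem_filter, Finset.mem_insert,
              Finset.mem_singleton]
            grind
          · refine Finset.disjoint_left.2 fun x => ?_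
            simp only [Finset.mem_filter, Finset.mem_insert, Finset.mem_singleton]
            grind
        rw [gnone (fun x => i < x ∧ x < j) (by grind) (by grind),
          show V.filter (fun x => i < x ∧ x < j) = ∅ by
            ext x; simp only [Finset.mem_filter, Finset.notMem_empty, iff_false]; grind,
          show V.filter (fun x => x < i ∨ j < x) = V by
            ext x; simp only [Finset.mem_filter]; grind,
          card_cellChoices_glue_both hT hVE hEne (Finset.filter_subset _ _) hF subset_rfl ha hb
            hab.ne,
          hfull, hone a ha, hone b hb, hpair, card_cellChoices_empty, Finset.card_empty]

/-- A family of cells that do not cross and that leave no gap unfilled is a glued polygon. -/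
theorem IsGlued.of_noncrossing {d : ℕ} (hd : 3 ≤ d) {T : Finset (Finset α)}
    (hcard : ∀ c ∈ T, c.card = d)
    (hcross : ∀ c ∈ T, ∀ c' ∈ T, c ≠ c' → ∀ x u y v, x < u → u < y → y < v →
      x ∈ c → y ∈ c → u ∈ c' → v ∈ c' → False)
    (hfill : ∀ a b, a < b → (∃ x, a < x ∧ x < b) →
      (∀ c ∈ T, (∀ x ∈ c, a ≤ x ∧ x ≤ b) ∨ ∀ x ∈ c, x ≤ a ∨ b ≤ x) →
      ∃ c ∈ T, a ∈ c ∧ b ∈ c ∧ ∀ x ∈ c, a ≤ x ∧ x ≤ b)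
    {lo hi : α} (hlohi : lo < hi) (hlo : ∀ x, lo ≤ x) (hhi : ∀ x, x ≤ hi) :
    IsGlued (d - 2) Finset.univ T := by
  suffices H : ∀ k : ℕ, ∀ V : Finset α, ∀ T₀ ⊆ T, (T \ T₀).card = k → IsGlued (d - 2) V T₀ →
      lo ∈ V → hi ∈ V →
      (∀ c ∈ T, c ∉ T₀ → ∃ a ∈ V, ∃ b ∈ V, a < b ∧ (∀ x ∈ V, x ≤ a ∨ b ≤ x) ∧
        ∀ x ∈ c, a ≤ x ∧ x ≤ b) →
      IsGlued (d - 2) Finset.univ T from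
    H _ {lo, hi} ∅ (Finset.empty_subset _) rfl (.base hlohi) (by simp) (by simp)
      fun c _ _ => ⟨lo, by simp, hi, by simp, hlohi, by simp, fun x _ => ⟨hlo x, hhi x⟩⟩
  intro k
  induction k using Nat.strong_induction_on with
  | _ k ih =>
    intro V T₀ hT₀ hk hgl hloV hhiV hgap
    by_cases hVu : ∀ x, x ∈ V
    · obtain rfl : T₀ = T := by
        refine Finset.Subset.antisymm hT₀ fun c hc => ?_
        by_contra hcT
        obtain ⟨a, -, b, -, hab, hV, hcab⟩ := hgap c hc hcT
        have : c ⊆ {a, b} := fun x hx => by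
          have h1 := hcab x hx
          have h2 := hV x (hVu x)
          simp only [Finset.mem_insert, Finset.mem_singleton]
          grind
        have h1 := (Finset.card_le_card this).trans Finset.card_le_two
        have h2 := hcard c hc
        omega
      rwa [Finset.eq_univ_iff_forall.2 hVu] at hgl
    push Not at hVu
    obtain ⟨x, hxV⟩ := hVu
    have hlow : (V.filter (· < x)).Nonempty :=
      ⟨lo, by simpa [hloV] using (hlo x).lt_of_ne (by grind)⟩
    have hupp : (V.filter (x < ·)).Nonempty :=
      ⟨hi, by simpa [hhiV] using (hhi x).lt_of_ne (by grind)⟩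
    obtain ⟨a, ha, hamax⟩ : ∃ u ∈ V.filter (· < x), ∀ y ∈ V.filter (· < x), y ≤ u :=
      ⟨_, Finset.max'_mem _ hlow, fun y hy => Finset.le_max' _ _ hy⟩
    obtain ⟨b, hb, hbmin⟩ : ∃ v ∈ V.filter (x < ·), ∀ y ∈ V.filter (x < ·), v ≤ y :=
      ⟨_, Finset.min'_mem _ hupp, fun y hy => Finset.min'_le _ _ hy⟩
    simp only [Finset.mem_filter] at ha hamax hb hbmin
    obtain ⟨haV, hax⟩ := ha
    obtain ⟨hbV, hxb⟩ := hb
    have hab := hax.trans hxb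
    have hV : ∀ y ∈ V, y ≤ a ∨ b ≤ y := by
      intro y hy
      rcases lt_trichotomy y x with h | h | h
      · exact Or.inl (hamax y ⟨hy, h⟩)
      · exact absurd (h ▸ hy) hxV
      · exact Or.inr (hbmin y ⟨hy, h⟩)
    obtain ⟨c, hc, hac, hbc, hcab⟩ := hfill a b hab ⟨x, hax, hxb⟩ (by
      intro c hc
      by_cases hcT : c ∈ T₀
      · exact Or.inr fun y hy => hV y (hgl.subset c hcT hy)
      · obtain ⟨a', ha', b', hb', hab', hV', hc'⟩ := hgap c hc hcT
        have h1 := hV a' ha'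
        have h2 := hV b' hb'
        have h3 := hV' a haV
        have h4 := hV' b hbV
        rcases h1 with h1 | h1
        · rcases h3 with h3 | h3
          · obtain rfl := le_antisymm h1 h3
            obtain rfl : b' = b := by grind
            exact Or.inl hc'
          · exact Or.inr fun y hy => Or.inl ((hc' y hy).2.trans h3)
        · exact Or.inr fun y hy => Or.inr (h1.trans (hc' y hy).1))
    have hcc := hcard c hc
    have hE : ∀ y ∈ (c.erase a).erase b, a < y ∧ y < b := by
      intro y hy
      simp only [Finset.mem_erase] at hy
      have := hcab y hy.2.2
      grind
    have hEcard : ((c.erase a).erase b).card = d - 2 := by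
      rw [Finset.card_erase_of_mem (by simp [hbc, hab.ne']), Finset.card_erase_of_mem hac, hcc]
      omega
    have hcE : insert a (insert b ((c.erase a).erase b)) = c := by
      rw [Finset.insert_erase (by simp [hbc, hab.ne']), Finset.insert_erase hac]
    have hcT₀ : c ∉ T₀ := by
      intro hcT
      obtain ⟨y, hy⟩ := Finset.card_pos.1 (by omega : 0 < ((c.erase a).erase b).card)
      have h1 := hE y hy
      have h2 := hV y (hgl.subset c hcT (Finset.mem_of_mem_erase (Finset.mem_of_mem_erase hy)))
      grind
    have hgl' := hgl.glue haV hbV hab hV hE hEcard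
    rw [hcE] at hgl'
    have hmemc : ∀ y ∈ c, y ∈ V ∪ (c.erase a).erase b := by
      intro y hy
      simp only [Finset.mem_union, Finset.mem_erase]
      grind
    refine ih (T \ insert c T₀).card ?_ (V ∪ (c.erase a).erase b) (insert c T₀) ?_ rfl hgl'
      (Finset.mem_union_left _ hloV) (Finset.mem_union_left _ hhiV) ?_
    · rw [← hk]
      refine Finset.card_lt_card ⟨Finset.sdiff_subset_sdiff subset_rfl (Finset.subset_insert _ _),
        fun h => ?_⟩
      simpa using h (Finset.mem_sdiff.2 ⟨hc, hcT₀⟩)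
    · exact Finset.insert_subset hc hT₀
    · intro c' hc' hc'T
      simp only [Finset.mem_insert, not_or] at hc'T
      obtain ⟨a', ha', b', hb', hab', hV', hcab'⟩ := hgap c' hc' hc'T.2
      have h1 := hV a' ha'
      have h2 := hV b' hb'
      have h3 := hV' a haV
      have h4 := hV' b hbV
      by_cases haa : a' = a
      · obtain rfl := haa
        obtain rfl : b' = b := by grind
        obtain ⟨u, hu, v, hv, huv, hgapc, hsub⟩ := exists_gap_of_noncrossing hac hbc
          (Ne.symm hc'T.1) (by rw [hcc, hcard c' hc']) (by rw [hcard c' hc']; exact hd)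
          hcab hcab' (hcross c hc c' hc' (Ne.symm hc'T.1)) (hcross c' hc' c hc hc'T.1)
        refine ⟨u, hmemc u hu, v, hmemc v hv, huv, fun y hy => ?_, hsub⟩
        rcases Finset.mem_union.1 hy with hy | hy
        · have h5 := hV y hy
          have h6 := hcab u hu
          have h7 := hcab v hv
          grind
        · exact hgapc y (Finset.mem_of_mem_erase (Finset.mem_of_mem_erase hy))
      · refine ⟨a', Finset.mem_union_left _ ha', b', Finset.mem_union_left _ hb', hab',
          fun y hy => ?_, hcab'⟩
        rcases Finset.mem_union.1 hy with hy | hy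
        · exact hV' y hy
        · have h5 := hE y hy
          grind

end Combinatorics

section Geometry

/-- Twice the signed area of the triangle `p q r`. -/
def signedArea (p q r : ℝ × ℝ) : ℝ :=
  (q.1 - p.1) * (r.2 - p.2) - (q.2 - p.2) * (r.1 - p.1)

theorem signedArea_rotate (p q r : ℝ × ℝ) : signedArea q r p = signedArea p q r := by
  simp only [signedArea]; ring

theorem signedArea_swap (p q r : ℝ × ℝ) : signedArea p r q = -signedArea p q r := by
  simp only [signedArea]; ring

theorem signedArea_circle (α β γ : ℝ) :
    signedArea (Real.cos α, Real.sin α) (Real.cos β, Real.sin β) (Real.cos γ, Real.sin γ) =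
      4 * Real.sin ((β - α) / 2) * Real.sin ((γ - β) / 2) * Real.sin ((γ - α) / 2) := by
  obtain ⟨x, rfl⟩ : ∃ x, α = 2 * x := ⟨α / 2, by ring⟩
  obtain ⟨y, rfl⟩ : ∃ y, β = 2 * y := ⟨β / 2, by ring⟩
  obtain ⟨z, rfl⟩ : ∃ z, γ = 2 * z := ⟨γ / 2, by ring⟩
  rw [show (2 * y - 2 * x) / 2 = y - x by ring, show (2 * z - 2 * y) / 2 = z - y by ring,
    show (2 * z - 2 * x) / 2 = z - x by ring]
  simp only [signedArea, Real.sin_sub, Real.cos_two_mul', Real.sin_two_mul]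
  have hx := Real.sin_sq_add_cos_sq x
  have hy := Real.sin_sq_add_cos_sq y
  have hz := Real.sin_sq_add_cos_sq z
  generalize Real.sin x = sx at *
  generalize Real.sin y = sy at *
  generalize Real.sin z = sz at *
  generalize Real.cos x = cx at *
  generalize Real.cos y = cy at *
  generalize Real.cos z = cz at *
  linear_combination
    -((cy ^ 2 - sy ^ 2) * (2 * sz * cz) - (2 * sy * cy) * (cz ^ 2 - sz ^ 2)) * hx -
    ((cx ^ 2 - sx ^ 2) * (2 * sy * cy) - (2 * sx * cx) * (cy ^ 2 - sy ^ 2)) * hz -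
    ((cz ^ 2 - sz ^ 2) * (2 * sx * cx) - (2 * sz * cz) * (cx ^ 2 - sx ^ 2)) * hy

theorem signedArea_vtx_pos {n : ℕ} {i j k : Fin (n + 1)} (hij : i < j) (hjk : j < k) :
    0 < signedArea (vtx (n + 1) i) (vtx (n + 1) j) (vtx (n + 1) k) := by
  have key : ∀ {p q : Fin (n + 1)}, p < q → 0 < Real.sin
      ((2 * Real.pi * ((q : ℕ) : ℝ) / ((n + 1 : ℕ) : ℝ) -
        2 * Real.pi * ((p : ℕ) : ℝ) / ((n + 1 : ℕ) : ℝ)) / 2) := by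
    intro p q hpq
    have h1 : ((p : ℕ) : ℝ) < ((q : ℕ) : ℝ) := by exact_mod_cast hpq
    have h2 : ((q : ℕ) : ℝ) < ((n + 1 : ℕ) : ℝ) := by exact_mod_cast q.2
    have h3 : (0 : ℝ) ≤ ((p : ℕ) : ℝ) := by positivity
    have h4 : (0 : ℝ) < ((n + 1 : ℕ) : ℝ) := by positivity
    rw [show (2 * Real.pi * ((q : ℕ) : ℝ) / ((n + 1 : ℕ) : ℝ) -
        2 * Real.pi * ((p : ℕ) : ℝ) / ((n + 1 : ℕ) : ℝ)) / 2 =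
        Real.pi * ((((q : ℕ) : ℝ) - ((p : ℕ) : ℝ)) / ((n + 1 : ℕ) : ℝ)) by ring]
    apply Real.sin_pos_of_pos_of_lt_pi
    · have := sub_pos.2 h1
      positivity
    · have : (((q : ℕ) : ℝ) - ((p : ℕ) : ℝ)) / ((n + 1 : ℕ) : ℝ) < 1 := by
        rw [div_lt_one h4]; linarith
      nlinarith [Real.pi_pos]
  have := mul_pos (mul_pos (mul_pos (by norm_num : (0 : ℝ) < 4) (key hij)) (key hjk))
    (key (hij.trans hjk))
  rw [← signedArea_circle] at this
  exact this

theorem signedArea_vtx_neg {n : ℕ} {p q x : Fin (n + 1)} (hpx : p < x) (hxq : x < q) :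
    signedArea (vtx (n + 1) p) (vtx (n + 1) q) (vtx (n + 1) x) < 0 := by
  rw [signedArea_swap, neg_lt_zero]
  exact signedArea_vtx_pos hpx hxq

theorem signedArea_vtx_nonpos {n : ℕ} {p q x : Fin (n + 1)} (hpx : p ≤ x) (hxq : x ≤ q) :
    signedArea (vtx (n + 1) p) (vtx (n + 1) q) (vtx (n + 1) x) ≤ 0 := by
  rcases hpx.eq_or_lt with rfl | hpx
  · simp [signedArea]
  rcases hxq.eq_or_lt with rfl | hxq
  · simp only [signedArea]; exact le_of_eq (by ring)
  exact (signedArea_vtx_neg hpx hxq).le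

theorem signedArea_vtx_pos_of_outside {n : ℕ} {p q x : Fin (n + 1)} (hpq : p < q)
    (hx : x < p ∨ q < x) :
    0 < signedArea (vtx (n + 1) p) (vtx (n + 1) q) (vtx (n + 1) x) := by
  rcases hx with hx | hx
  · rw [signedArea_rotate]
    exact signedArea_vtx_pos hx hpq
  · exact signedArea_vtx_pos hpq hx

theorem signedArea_vtx_nonneg {n : ℕ} {p q x : Fin (n + 1)} (hpq : p < q)
    (hx : x ≤ p ∨ q ≤ x) :
    0 ≤ signedArea (vtx (n + 1) p) (vtx (n + 1) q) (vtx (n + 1) x) := by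
  by_cases h : x < p ∨ q < x
  · exact (signedArea_vtx_pos_of_outside hpq h).le
  · obtain rfl | rfl : x = p ∨ x = q := by
      push Not at h
      rcases hx with hx | hx
      · exact Or.inl (le_antisymm hx h.1)
      · exact Or.inr (le_antisymm h.2 hx)
    · simp [signedArea]
    · simp only [signedArea]; exact le_of_eq (by ring)

theorem signedArea_combo (p q x y : ℝ × ℝ) {s t : ℝ} (hst : s + t = 1) :
    signedArea p q (s • x + t • y) = s * signedArea p q x + t * signedArea p q y := by
  obtain rfl : s = 1 - t := by linarith
  simp only [signedArea, Prod.fst_add, Prod.snd_add, Prod.smul_fst, Prod.smul_snd, smul_eq_mul]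
  ring

theorem convex_signedArea_nonneg (p q : ℝ × ℝ) : Convex ℝ {x | 0 ≤ signedArea p q x} := by
  intro x hx y hy s t hs ht hst
  simp only [Set.mem_ofPred_eq] at *
  rw [signedArea_combo p q x y hst]
  positivity

theorem convex_signedArea_nonpos (p q : ℝ × ℝ) : Convex ℝ {x | signedArea p q x ≤ 0} := by
  intro x hx y hy s t hs ht hst
  simp only [Set.mem_ofPred_eq] at *
  rw [signedArea_combo p q x y hst]
  nlinarith

theorem cellHull_subset {n : ℕ} {c : Finset (ZMod n)} {s : Set (ℝ × ℝ)} (hs : Convex ℝ s)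
    (h : ∀ x ∈ c, vtx n x ∈ s) : cellHull n c ⊆ s :=
  convexHull_min (by rintro _ ⟨x, hx, rfl⟩; exact h x hx) hs

theorem vtx_mem_cellHull {n : ℕ} {c : Finset (ZMod n)} {x : ZMod n} (hx : x ∈ c) :
    vtx n x ∈ cellHull n c :=
  subset_convexHull ℝ _ ⟨x, hx, rfl⟩

theorem interior_convexHull_nonempty_of_signedArea_pos {s : Set (ℝ × ℝ)} {p q r : ℝ × ℝ}
    (hp : p ∈ s) (hq : q ∈ s) (hr : r ∈ s) (h : 0 < signedArea p q r) :
    (interior (convexHull ℝ s)).Nonempty := by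
  have hcont : ∀ a b : ℝ × ℝ, Continuous (signedArea a b) := fun a b => by
    unfold signedArea; fun_prop
  have hopen : IsOpen {x | 0 < signedArea p q x ∧ 0 < signedArea q r x ∧ 0 < signedArea r p x} :=
    (isOpen_lt continuous_const (hcont _ _)).inter ((isOpen_lt continuous_const (hcont _ _)).inter
      (isOpen_lt continuous_const (hcont _ _)))
  refine ⟨(3⁻¹ : ℝ) • (p + q + r), interior_maximal ?_ hopen ?_⟩
  · rintro x ⟨h1, h2, h3⟩
    have hsum : signedArea q r x / signedArea p q r + signedArea r p x / signedArea p q r +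
        signedArea p q x / signedArea p q r = 1 := by
      rw [← add_div, ← add_div, div_eq_one_iff_eq h.ne']
      simp only [signedArea]; ring
    have hx : x = (signedArea q r x / signedArea p q r) • p +
        (signedArea r p x / signedArea p q r) • q + (signedArea p q x / signedArea p q r) • r := by
      have h' := h.ne'
      refine Prod.ext ?_ ?_ <;>
        simp only [Prod.fst_add, Prod.snd_add, Prod.smul_fst, Prod.smul_snd, smul_eq_mul] <;>
        field_simp <;> simp only [signedArea] <;> ring
    rw [hx]
    have hconv := convex_convexHull ℝ s
    have := hconv.sum_mem (t := Finset.univ)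
      (w := ![signedArea q r x / signedArea p q r, signedArea r p x / signedArea p q r,
        signedArea p q x / signedArea p q r]) (z := ![p, q, r])
      (by intro i _; fin_cases i <;> simp <;> positivity)
      (by simpa [Fin.sum_univ_three] using hsum)
      (by intro i _; fin_cases i <;> simp <;> apply subset_convexHull <;> assumption)
    simpa [Fin.sum_univ_three] using this
  · simp only [Set.mem_ofPred_eq]
    have e : ∀ a b : ℝ × ℝ, signedArea a b ((3⁻¹ : ℝ) • (p + q + r)) =
        3⁻¹ * (signedArea a b p + signedArea a b q + signedArea a b r) := by
      intro a b
      simp only [signedArea, Prod.fst_add, Prod.snd_add, Prod.smul_fst, Prod.smul_snd, smul_eq_mul]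
      ring
    simp only [e]
    simp only [signedArea] at *
    refine ⟨?_, ?_, ?_⟩ <;> nlinarith


theorem exists_min_max_of_card {α : Type*} [LinearOrder α] {c : Finset α} (hc : 3 ≤ c.card) :
    ∃ p ∈ c, ∃ q ∈ c, (∀ x ∈ c, p ≤ x ∧ x ≤ q) ∧ ∃ r ∈ c, p < r ∧ r < q := by
  have hne : c.Nonempty := Finset.card_pos.1 (by omega)
  refine ⟨_, c.min'_mem hne, _, c.max'_mem hne,
    fun x hx => ⟨c.min'_le x hx, c.le_max' x hx⟩, ?_⟩
  obtain ⟨r, hr, hr'⟩ := Finset.exists_mem_notMem_of_card_lt_card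
    (lt_of_le_of_lt (Finset.card_le_two (a := c.min' hne) (b := c.max' hne))
      (by omega : 2 < c.card))
  simp only [Finset.mem_insert, Finset.mem_singleton, not_or] at hr'
  exact ⟨r, hr, lt_of_le_of_ne (c.min'_le r hr) (Ne.symm hr'.1),
    lt_of_le_of_ne (c.le_max' r hr) hr'.2⟩

theorem interior_cellHull_nonempty {n : ℕ} {c : Finset (Fin (n + 1))} (hc : 3 ≤ c.card) :
    (interior (cellHull (n + 1) c)).Nonempty := by
  obtain ⟨p, hp, q, hq, -, r, hr, hpr, hrq⟩ := exists_min_max_of_card hc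
  exact interior_convexHull_nonempty_of_signedArea_pos ⟨p, hp, rfl⟩ ⟨r, hr, rfl⟩ ⟨q, hq, rfl⟩
    (signedArea_vtx_pos hpr hrq)

/-- Cells with crossing chords overlap. -/
theorem interior_cellHull_inter_nonempty {n : ℕ} {c c' : Finset (Fin (n + 1))}
    (hc : 3 ≤ c.card) (hc' : 3 ≤ c'.card) {x u y v : Fin (n + 1)} (hxu : x < u) (huy : u < y)
    (hyv : y < v) (hx : x ∈ c) (hy : y ∈ c) (hu : u ∈ c') (hv : v ∈ c') :
    (interior (cellHull (n + 1) c) ∩ interior (cellHull (n + 1) c')).Nonempty := by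
  rw [← Set.not_disjoint_iff_nonempty_inter]
  intro hdisj
  have hconv : ∀ c : Finset (ZMod (n + 1)), Convex ℝ (cellHull (n + 1) c) :=
    fun c => convex_convexHull ℝ _
  obtain ⟨f, t, h1, h2⟩ := geometric_hahn_banach_open_open (hconv c).interior isOpen_interior
    (hconv c').interior isOpen_interior hdisj
  have h1' : ∀ p ∈ cellHull (n + 1) c, f p ≤ t := by
    intro p hp
    have hp' := subset_closure hp
    rw [← (hconv c).closure_interior_eq_closure_of_nonempty_interior
      (interior_cellHull_nonempty hc)] at hp'
    exact closure_minimal (fun q hq => (h1 q hq).le)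
      (isClosed_le f.continuous continuous_const) hp'
  have h2' : ∀ p ∈ cellHull (n + 1) c', t ≤ f p := by
    intro p hp
    have hp' := subset_closure hp
    rw [← (hconv c').closure_interior_eq_closure_of_nonempty_interior
      (interior_cellHull_nonempty hc')] at hp'
    exact closure_minimal (fun q hq => (h2 q hq).le)
      (isClosed_le continuous_const f.continuous) hp'
  have hf : ∀ p : ℝ × ℝ, f p = p.1 * f (1, 0) + p.2 * f (0, 1) := by
    intro p
    rw [← smul_eq_mul, ← smul_eq_mul, ← map_smul, ← map_smul, ← map_add]
    simp
  have hfx := h1' _ (vtx_mem_cellHull hx)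
  have hfy := h1' _ (vtx_mem_cellHull hy)
  have hfu := h2' _ (vtx_mem_cellHull hu)
  have hfv := h2' _ (vtx_mem_cellHull hv)
  have a1 := signedArea_vtx_pos huy hyv
  have a2 := signedArea_vtx_pos hxu (huy.trans hyv)
  have a3 := signedArea_vtx_pos (hxu.trans huy) hyv
  have a4 := signedArea_vtx_pos hxu huy
  obtain ⟨p, hp⟩ := interior_cellHull_nonempty hc
  obtain ⟨q, hq⟩ := interior_cellHull_nonempty hc'
  have hpt := h1 p hp
  have hqt := h2 q hq
  generalize vtx (n + 1) x = X at *
  generalize vtx (n + 1) u = U at *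
  generalize vtx (n + 1) y = Y at *
  generalize vtx (n + 1) v = W at *
  have hdep : signedArea U Y W * f X + signedArea X U W * f Y =
      signedArea X Y W * f U + signedArea X U Y * f W := by
    rw [hf X, hf Y, hf U, hf W]
    simp only [signedArea]
    ring
  have hsum : signedArea U Y W + signedArea X U W = signedArea X Y W + signedArea X U Y := by
    simp only [signedArea]
    ring
  have m1 := mul_nonneg a1.le (sub_nonneg.2 hfx)
  have m2 := mul_nonneg a2.le (sub_nonneg.2 hfy)
  have m3 := mul_nonneg a3.le (sub_nonneg.2 hfu)
  have m4 := mul_nonneg a4.le (sub_nonneg.2 hfv)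
  have hzero : signedArea U Y W * (t - f X) + signedArea X U W * (t - f Y) +
      signedArea X Y W * (f U - t) + signedArea X U Y * (f W - t) = 0 := by
    linear_combination t * hsum - hdep
  have e1 : f X = t := by
    have := (mul_eq_zero.1 (by linarith : signedArea U Y W * (t - f X) = 0)).resolve_left a1.ne'
    linarith
  have e2 : f Y = t := by
    have := (mul_eq_zero.1 (by linarith : signedArea X U W * (t - f Y) = 0)).resolve_left a2.ne'
    linarith
  have e3 : f U = t := by
    have := (mul_eq_zero.1 (by linarith : signedArea X Y W * (f U - t) = 0)).resolve_left a3.ne'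
    linarith
  rw [hf] at e1 e2 e3
  have z1 : f (1, 0) * signedArea X U Y = 0 := by
    simp only [signedArea]
    linear_combination (Y.2 - X.2) * (e3 - e1) - (U.2 - X.2) * (e2 - e1)
  have z2 : f (0, 1) * signedArea X U Y = 0 := by
    simp only [signedArea]
    linear_combination (U.1 - X.1) * (e2 - e1) - (Y.1 - X.1) * (e3 - e1)
  have z1' := (mul_eq_zero.1 z1).resolve_right a4.ne'
  have z2' := (mul_eq_zero.1 z2).resolve_right a4.ne'
  rw [hf, z1', z2'] at hpt hqt
  linarith

/-- A chord that no cell of the dissection crosses, with vertices beyond it, is spanned by a cell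
beyond it. -/
theorem IsDAngulation.exists_spanning_cell {n d : ℕ} (hd : 3 ≤ d)
    {T : Finset (Finset (Fin (n + 1)))} (hT : IsDAngulation (n + 1) d T) {a b : Fin (n + 1)}
    (hab : a < b) (hbeyond : ∃ x, a < x ∧ x < b)
    (h : ∀ c ∈ T, (∀ x ∈ c, a ≤ x ∧ x ≤ b) ∨ ∀ x ∈ c, x ≤ a ∨ b ≤ x) :
    ∃ c ∈ T, a ∈ c ∧ b ∈ c ∧ ∀ x ∈ c, a ≤ x ∧ x ≤ b := by
  obtain ⟨hcard, hcover, -⟩ := hT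
  obtain ⟨x, hax, hxb⟩ := hbeyond
  set M : ℝ × ℝ := (2⁻¹ : ℝ) • vtx (n + 1) a + (2⁻¹ : ℝ) • vtx (n + 1) b with hM
  have hMarea : ∀ p q, signedArea p q M =
      2⁻¹ * signedArea p q (vtx (n + 1) a) + 2⁻¹ * signedArea p q (vtx (n + 1) b) :=
    fun p q => signedArea_combo _ _ _ _ (by norm_num)
  have hvtx : ∀ k, vtx (n + 1) k ∈ convexHull ℝ (Set.range (vtx (n + 1))) :=
    fun k => subset_convexHull ℝ _ ⟨k, rfl⟩
  have hMmem : M ∈ convexHull ℝ (Set.range (vtx (n + 1))) :=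
    convex_convexHull ℝ _ (hvtx a) (hvtx b) (by norm_num) (by norm_num) (by norm_num)
  let K : Set (ℝ × ℝ) := ⋃ c ∈ {c ∈ T | ∀ x ∈ c, a ≤ x ∧ x ≤ b}, cellHull (n + 1) c
  have hK : IsClosed K := by
    refine isClosed_biUnion_finset fun c _ => ?_
    exact ((Set.toFinite _).isCompact_convexHull ℝ).isClosed
  let P : ℝ → ℝ × ℝ := fun t => (1 - t) • M + t • vtx (n + 1) x
  have hP : Continuous P := by fun_prop
  have hPK : Set.Ioc (0 : ℝ) 1 ⊆ P ⁻¹' K := by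
    rintro t ⟨ht0, ht1⟩
    have hPmem : P t ∈ convexHull ℝ (Set.range (vtx (n + 1))) :=
      convex_convexHull ℝ _ hMmem (hvtx x) (by linarith) ht0.le (by ring)
    rw [← hcover] at hPmem
    simp only [Set.mem_iUnion] at hPmem
    obtain ⟨c, hc, hPc⟩ := hPmem
    rcases h c hc with hin | hout
    · exact Set.mem_biUnion (Finset.mem_coe.2 (Finset.mem_filter.2 ⟨hc, hin⟩)) hPc
    · have hge := cellHull_subset (convex_signedArea_nonneg (vtx (n + 1) a) (vtx (n + 1) b))
        (fun y hy => signedArea_vtx_nonneg hab (hout y hy)) hPc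
      have hneg := signedArea_vtx_neg hax hxb
      simp only [Set.mem_ofPred_eq, P] at hge
      rw [signedArea_combo _ _ _ _ (by ring), hMarea] at hge
      have ha0 : signedArea (vtx (n + 1) a) (vtx (n + 1) b) (vtx (n + 1) a) = 0 := by
        simp [signedArea]
      have hb0 : signedArea (vtx (n + 1) a) (vtx (n + 1) b) (vtx (n + 1) b) = 0 := by
        simp only [signedArea]; ring
      rw [ha0, hb0] at hge
      nlinarith
  have h0 : P 0 ∈ K := by
    refine (hK.preimage hP).closure_subset_iff.2 hPK ?_
    rw [closure_Ioc (by norm_num)]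
    simp
  have h0M : P 0 = M := by simp [P]
  rw [h0M] at h0
  simp only [K, Set.mem_iUnion, Finset.mem_filter] at h0
  obtain ⟨c, ⟨hc, hcab⟩, hMc⟩ := h0
  obtain ⟨p, hp, q, hq, hpq, r, -, hpr, hrq⟩ := exists_min_max_of_card (α := Fin (n + 1))
    (hd.trans_eq (hcard c hc).symm)
  have hle := cellHull_subset (convex_signedArea_nonpos (vtx (n + 1) p) (vtx (n + 1) q))
    (fun y hy => signedArea_vtx_nonpos (hpq y hy).1 (hpq y hy).2) hMc
  simp only [Set.mem_ofPred_eq] at hle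
  rw [hMarea] at hle
  have hpq' := hpr.trans hrq
  have hA := signedArea_vtx_nonneg hpq' (Or.inl (hcab p hp).1)
  have hB := signedArea_vtx_nonneg hpq' (Or.inr (hcab q hq).2)
  refine ⟨c, hc, ?_, ?_, hcab⟩
  · rcases (hcab p hp).1.eq_or_lt with rfl | hlt
    · exact hp
    · have := signedArea_vtx_pos_of_outside hpq' (Or.inl hlt)
      linarith
  · rcases (hcab q hq).2.eq_or_lt with rfl | hlt
    · exact hq
    · have := signedArea_vtx_pos_of_outside hpq' (Or.inr hlt)
      linarith

end Geometry

theorem natCard_subtype_eq_card_cellChoices {α : Type*} [LinearOrder α] [Fintype α] (e : ℕ)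
    (T : Finset (Finset α)) {L : ℕ} {g : Fin L → α} (hg : g.Injective) :
    Nat.card {q : Fin L → {c // c ∈ T} // (∀ k, g k ∈ (q k : Finset α)) ∧
      ∀ c ∈ T, (Finset.univ.filter fun k => (q k : Finset α) = c).card ≤ e} =
      (cellChoices e T (Finset.univ.image g)).card := by
  have hcount : ∀ (f : α → Finset α) (c : Finset α),
      ((Finset.univ.image g).filter fun x => f x = c).card =
        (Finset.univ.filter fun k => f (g k) = c).card := by
    intro f c
    rw [Finset.filter_image, Finset.card_image_of_injective _ hg]
  rw [← Nat.card_eq_finsetCard]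
  symm
  have hmem : ∀ k, g k ∈ Finset.univ.image g := fun k =>
    Finset.mem_image_of_mem g (Finset.mem_univ k)
  refine Nat.card_eq_of_bijective (fun f => ⟨fun k => ⟨f.1 (g k),
    ((mem_cellChoices.1 f.2).1 _ (hmem k)).1⟩, fun k => ((mem_cellChoices.1 f.2).1 _ (hmem k)).2,
    fun c hc => hcount f.1 c ▸ (mem_cellChoices.1 f.2).2.2 c hc⟩) ⟨?_, ?_⟩
  · rintro ⟨f, hf⟩ ⟨f', hf'⟩ h
    simp only [Subtype.mk.injEq, funext_iff] at h ⊢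
    intro x
    by_cases hx : x ∈ Finset.univ.image g
    · obtain ⟨k, -, rfl⟩ := Finset.mem_image.1 hx
      exact h k
    · rw [(mem_cellChoices.1 hf).2.1 x hx, (mem_cellChoices.1 hf').2.1 x hx]
  · rintro ⟨q, hq1, hq2⟩
    have hext : ∀ k, Function.extend g (fun k => (q k : Finset α)) (fun _ => ∅) (g k) = q k :=
      fun k => hg.extend_apply _ _ k
    refine ⟨⟨Function.extend g (fun k => (q k : Finset α)) (fun _ => ∅),
      mem_cellChoices.2 ⟨?_, ?_, ?_⟩⟩, ?_⟩
    · intro x hx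
      obtain ⟨k, -, rfl⟩ := Finset.mem_image.1 hx
      rw [hext]
      exact ⟨(q k).2, hq1 k⟩
    · intro x hx
      exact Function.extend_apply' _ _ _ fun ⟨k, hk⟩ => hx (hk ▸ hmem k)
    · intro c hc
      rw [hcount]
      simp only [hext]
      exact hq2 c hc
    · simp [hext]

theorem val_add_one_add_natCast {n : ℕ} (i : ZMod (n + 1)) (k : ℕ) :
    (i + 1 + (k : ZMod (n + 1))).val = (i.val + 1 + k) % (n + 1) := by
  have : i + 1 + (k : ZMod (n + 1)) = ((i.val + 1 + k : ℕ) : ZMod (n + 1)) := by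
    push_cast
    rw [ZMod.natCast_zmod_val]
  rw [this, ZMod.val_natCast]

theorem pathLen_of_lt {n : ℕ} {i j : ZMod (n + 1)} (hij : i.val < j.val) :
    pathLen (n + 1) i j = j.val - i.val - 1 := by
  have h2 := j.val_lt
  have : j - i - 1 = ((j.val - (i.val + 1) : ℕ) : ZMod (n + 1)) := by
    rw [Nat.cast_sub (Nat.succ_le_of_lt hij)]
    push_cast
    rw [ZMod.natCast_zmod_val, ZMod.natCast_zmod_val]
    ring
  rw [pathLen, this, ZMod.val_natCast, Nat.sub_sub]
  exact Nat.mod_eq_of_lt (by omega)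

theorem pathLen_of_gt {n : ℕ} {i j : ZMod (n + 1)} (hij : i.val < j.val) :
    pathLen (n + 1) j i = n + i.val - j.val := by
  have h2 := j.val_lt
  have : i - j - 1 = ((n + i.val - j.val : ℕ) : ZMod (n + 1)) := by
    rw [Nat.cast_sub (by omega)]
    push_cast
    rw [ZMod.natCast_zmod_val, ZMod.natCast_zmod_val]
    have : ((n + 1 : ℕ) : ZMod (n + 1)) = 0 := ZMod.natCast_self _
    push_cast at this
    linear_combination -this
  rw [pathLen, this, ZMod.val_natCast]
  exact Nat.mod_eq_of_lt (by omega)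

theorem dPathCount_eq_card_cellChoices {n d : ℕ} (T : Finset (Finset (Fin (n + 1))))
    (i j : Fin (n + 1)) (S : Finset (Fin (n + 1))) (hL : pathLen (n + 1) i j ≤ n)
    (hS : ∀ x : Fin (n + 1), x ∈ S ↔
      ∃ k < pathLen (n + 1) i j, ((i : ℕ) + 1 + k) % (n + 1) = x) :
    dPathCount (n + 1) d T i j = (cellChoices (d - 2) T S).card := by
  let i' : ZMod (n + 1) := i
  let g : Fin (pathLen (n + 1) i j) → Fin (n + 1) :=
    fun k => show ZMod (n + 1) from i' + 1 + ((k : ℕ) : ZMod (n + 1))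
  have hgval : ∀ k, (g k : ℕ) = ((i : ℕ) + 1 + k) % (n + 1) :=
    fun k => val_add_one_add_natCast i' k
  have hg : g.Injective := by
    intro k l hkl
    have h1 := hgval k
    rw [hkl, hgval l] at h1
    have h2 : (l : ℕ) ≡ k [MOD n + 1] := Nat.ModEq.add_left_cancel' _ h1
    exact Fin.ext (Nat.ModEq.eq_of_lt_of_lt h2 (by omega) (by omega)).symm
  have hgS : Finset.univ.image g = S := by
    ext x
    simp only [Finset.mem_image, Finset.mem_univ, true_and, hS, Fin.ext_iff, hgval]
    exact ⟨fun ⟨k, hk⟩ => ⟨k, k.2, hk⟩, fun ⟨k, hk, h⟩ => ⟨⟨k, hk⟩, h⟩⟩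
  rw [← hgS, ← natCard_subtype_eq_card_cellChoices (d - 2) T hg]
  refine Nat.card_congr (Equiv.subtypeEquivRight fun q =>
    and_congr Iff.rfl (forall₂_congr fun c _ => ?_))
  exact iff_of_eq (congrArg (fun s => Finset.card s ≤ d - 2) (Finset.filter_congr_decidable _ _ _))

theorem IsDAngulation.isGlued {n d : ℕ} (hd : 3 ≤ d) (hn : 0 < n)
    {T : Finset (Finset (Fin (n + 1)))} (hT : IsDAngulation (n + 1) d T) :
    IsGlued (d - 2) Finset.univ T := by
  have hcard : ∀ c ∈ T, 3 ≤ c.card := fun c hc => hd.trans_eq (hT.1 c hc).symm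
  refine IsGlued.of_noncrossing hd hT.1 ?_
    (fun a b hab hx h => hT.exists_spanning_cell hd hab hx h) (lo := 0) (hi := Fin.last n)
    (Fin.lt_def.2 hn) Fin.zero_le Fin.le_last
  intro c hc c' hc' hne x u y v hxu huy hyv hx hy hu hv
  have := interior_cellHull_inter_nonempty (hcard c hc) (hcard c' hc') hxu huy hyv hx hy hu hv
  rw [hT.2.2 c hc c' hc' hne] at this
  exact Set.not_nonempty_empty this

theorem dPathCount_symm_of_lt {n d : ℕ} (hd : 3 ≤ d) (hn : 0 < n)
    {T : Finset (Finset (Fin (n + 1)))} (hT : IsDAngulation (n + 1) d T) {i j : Fin (n + 1)}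
    (hij : i < j) : dPathCount (n + 1) d T i j = dPathCount (n + 1) d T j i := by
  have h1 : (i : ℕ) < j := hij
  have h2 := j.2
  have hlen : pathLen (n + 1) i j = (j : ℕ) - i - 1 := pathLen_of_lt h1
  have hlen' : pathLen (n + 1) j i = n + (i : ℕ) - j := pathLen_of_gt h1
  rw [dPathCount_eq_card_cellChoices T i j {x | i < x ∧ x < j} (by omega),
    dPathCount_eq_card_cellChoices T j i {x | x < i ∨ j < x} (by omega)]
  · exact (hT.isGlued hd hn).card_cellChoices_eq (by omega) (Finset.mem_univ i)
      (Finset.mem_univ j) hij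
  · intro x
    have hx := x.2
    rw [hlen']
    simp only [Finset.mem_filter, Finset.mem_univ, true_and, Fin.lt_def]
    constructor
    · rintro (h | h)
      · refine ⟨n + x - j, by omega, ?_⟩
        rw [show (j : ℕ) + 1 + (n + x - j) = x + (n + 1) by omega, Nat.add_mod_right,
          Nat.mod_eq_of_lt hx]
      · refine ⟨x - j - 1, by omega, ?_⟩
        rw [show (j : ℕ) + 1 + (x - j - 1) = x by omega, Nat.mod_eq_of_lt hx]
    · rintro ⟨k, hk, h⟩
      by_cases hlt : (j : ℕ) + 1 + k < n + 1
      · rw [Nat.mod_eq_of_lt hlt] at h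
        omega
      · rw [Nat.mod_eq_sub_mod (by omega), Nat.mod_eq_of_lt (by omega)] at h
        omega
  · intro x
    have hx := x.2
    rw [hlen]
    simp only [Finset.mem_filter, Finset.mem_univ, true_and, Fin.lt_def]
    constructor
    · rintro ⟨h, h'⟩
      refine ⟨x - i - 1, by omega, ?_⟩
      rw [show (i : ℕ) + 1 + (x - i - 1) = x by omega, Nat.mod_eq_of_lt hx]
    · rintro ⟨k, hk, h⟩
      rw [Nat.mod_eq_of_lt (by omega)] at h
      omega

/-- For any `d`-angulation `T` of the convex `n`-gon, `n = d + m * (d - 2)`, the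
matrix of `d`-path numbers is symmetric: `m_{i,j} = m_{j,i}` for all vertices. -/
theorem dPathCount_symm (d m n : ℕ) (hd : 3 ≤ d) (hn : n = d + m * (d - 2))
    (T : Finset (Finset (ZMod n))) (hT : IsDAngulation n d T) (i j : ZMod n) :
    dPathCount n d T i j = dPathCount n d T j i := by
  obtain ⟨k, rfl⟩ : ∃ k, n = k + 1 := ⟨n - 1, by omega⟩
  have hk : 0 < k := by omega
  rcases lt_trichotomy (α := Fin (k + 1)) i j with hij | hij | hij
  · exact dPathCount_symm_of_lt hd hk hT hij
  · have hij' : i = j := hij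
    rw [hij']
  · exact (dPathCount_symm_of_lt hd hk hT hij).symm
end
end

section
/- Let T be a d-angulation of a convex n-gon, n = d + m(d−2). Then for every vertex i, the number of d-paths satisfies m_{i,i} = 0 and m_{i,i+1} = 1, and every d-path from i+1 to i has length n−2 and contains every d-gon of T exactly d−2 times. -/
noncomputable section

open Filter Topology

/-- Twice the signed area of the triangle `x y z`. -/
def orient (x y z : ℝ × ℝ) : ℝ :=
  (y.1 - x.1) * (z.2 - x.2) - (y.2 - x.2) * (z.1 - x.1)

/-- The elements of `c` lying strictly between two others, in the order given by `ZMod.val`. -/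
def innerVertices {n : ℕ} (c : Finset (ZMod n)) : Finset (ZMod n) :=
  c.filter fun v => (∃ u ∈ c, u.val < v.val) ∧ ∃ w ∈ c, v.val < w.val

lemma mem_innerVertices {n : ℕ} {c : Finset (ZMod n)} {v : ZMod n} :
    v ∈ innerVertices c ↔
      v ∈ c ∧ (∃ u ∈ c, u.val < v.val) ∧ ∃ w ∈ c, v.val < w.val := by
  simp [innerVertices]

lemma card_innerVertices {n : ℕ} [NeZero n] (c : Finset (ZMod n)) (hc : 2 ≤ c.card) :
    (innerVertices c).card = c.card - 2 := by
  have hne : c.Nonempty := Finset.card_pos.mp (by omega)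
  obtain ⟨a, ha, hmin⟩ := c.exists_min_image ZMod.val hne
  obtain ⟨b, hb, hmax⟩ := c.exists_max_image ZMod.val hne
  have hab : a ≠ b := by
    rintro rfl
    obtain ⟨x, hx, y, hy, hxy⟩ := Finset.one_lt_card.mp (show 1 < c.card by omega)
    apply hxy
    apply ZMod.val_injective n
    linarith [hmin x hx, hmax x hx, hmin y hy, hmax y hy]
  have key : innerVertices c = (c.erase a).erase b := by
    ext v
    simp only [mem_innerVertices, Finset.mem_erase]
    constructor
    · rintro ⟨hv, ⟨u, hu, huv⟩, w, hw, hvw⟩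
      refine ⟨?_, ?_, hv⟩
      · rintro rfl
        exact absurd (hmax w hw) (by omega)
      · rintro rfl
        exact absurd (hmin u hu) (by omega)
    · rintro ⟨hvb, hva, hv⟩
      exact ⟨hv,
        ⟨a, ha, lt_of_le_of_ne (hmin v hv) fun h => hva (ZMod.val_injective n h.symm)⟩,
        b, hb, lt_of_le_of_ne (hmax v hv) fun h => hvb (ZMod.val_injective n h)⟩
  rw [key, Finset.card_erase_of_mem (by simp [hab.symm, hb]), Finset.card_erase_of_mem ha]
  omega

lemma orient_vtx_pos {n : ℕ} [NeZero n] {a b c : ZMod n} (hab : a.val < b.val)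
    (hbc : b.val < c.val) : 0 < orient (vtx n a) (vtx n b) (vtx n c) := by
  have hn : (0 : ℝ) < n := by exact_mod_cast Nat.pos_of_ne_zero (NeZero.ne n)
  have hab' : (a.val : ℝ) < b.val := by exact_mod_cast hab
  have hbc' : (b.val : ℝ) < c.val := by exact_mod_cast hbc
  have hcn : (c.val : ℝ) < n := by exact_mod_cast ZMod.val_lt c
  have ha : (0 : ℝ) ≤ a.val := by positivity
  obtain ⟨p, hp⟩ : ∃ p, p = Real.pi * (b.val - a.val) / n := ⟨_, rfl⟩
  obtain ⟨q, hq⟩ : ∃ q, q = Real.pi * (c.val - b.val) / n := ⟨_, rfl⟩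
  have hp0 : 0 < p := by
    rw [hp]; exact div_pos (mul_pos Real.pi_pos (by linarith)) hn
  have hq0 : 0 < q := by
    rw [hq]; exact div_pos (mul_pos Real.pi_pos (by linarith)) hn
  have hpq : p + q < Real.pi := by
    rw [hp, hq, ← add_div, div_lt_iff₀ hn, ← mul_add]
    exact mul_lt_mul_of_pos_left (by linarith) Real.pi_pos
  have hb : 2 * Real.pi * b.val / n = 2 * Real.pi * a.val / n + 2 * p := by
    rw [hp]; ring
  have hc : 2 * Real.pi * c.val / n = 2 * Real.pi * a.val / n + 2 * (p + q) := by
    rw [hp, hq]; ring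
  have hprod : 0 < 4 * Real.sin p * Real.sin q * Real.sin (p + q) := by
    have := Real.sin_pos_of_pos_of_lt_pi hp0 (by linarith)
    have := Real.sin_pos_of_pos_of_lt_pi hq0 (by linarith)
    have := Real.sin_pos_of_pos_of_lt_pi (add_pos hp0 hq0) hpq
    positivity
  convert hprod using 1
  simp only [orient, vtx, hb, hc]
  generalize 2 * Real.pi * a.val / n = α
  have h₁ := Real.sin_sq_add_cos_sq α
  have h₂ := Real.sin_sq_add_cos_sq p
  have expand : ∀ x y : ℝ,
      (Real.cos (α + x) - Real.cos α) * (Real.sin (α + y) - Real.sin α) -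
        (Real.sin (α + x) - Real.sin α) * (Real.cos (α + y) - Real.cos α) =
      (Real.cos x - 1) * Real.sin y - Real.sin x * (Real.cos y - 1) := by
    intro x y
    simp only [Real.cos_add, Real.sin_add]
    linear_combination
      ((Real.cos x - 1) * Real.sin y - Real.sin x * (Real.cos y - 1)) * h₁
  rw [expand, Real.cos_two_mul', Real.cos_two_mul', Real.sin_two_mul, Real.sin_two_mul]
  have h₄ := Real.sin_sq_add_cos_sq (p + q)
  have hq' : Real.sin q = Real.sin (p + q) * Real.cos p - Real.cos (p + q) * Real.sin p := by
    rw [← Real.sin_sub]; congr 1; ring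
  rw [hq']
  generalize Real.sin (p + q) = S, Real.cos (p + q) = C at *
  generalize Real.sin p = s, Real.cos p = k at *
  have e₁ : k ^ 2 = 1 - s ^ 2 := by linarith
  have e₂ : C ^ 2 = 1 - S ^ 2 := by linarith
  rw [e₁, e₂]
  ring

lemma inner_vtx_lt_one {n : ℕ} [NeZero n] {v w : ZMod n} (h : w ≠ v) :
    (vtx n v).1 * (vtx n w).1 + (vtx n v).2 * (vtx n w).2 < 1 := by
  have hn : (0 : ℝ) < n := by exact_mod_cast Nat.pos_of_ne_zero (NeZero.ne n)
  simp only [vtx]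
  rw [← Real.cos_sub]
  refine lt_of_le_of_ne (Real.cos_le_one _) fun h1 => h ?_
  have hv : (v.val : ℝ) < n := by exact_mod_cast ZMod.val_lt v
  have hw : (w.val : ℝ) < n := by exact_mod_cast ZMod.val_lt w
  have hv0 : (0 : ℝ) ≤ v.val := by positivity
  have hw0 : (0 : ℝ) ≤ w.val := by positivity
  have e : 2 * Real.pi * v.val / n - 2 * Real.pi * w.val / n =
      2 * Real.pi * ((v.val - w.val) / n) := by ring
  have hpi := Real.pi_pos
  rw [e, Real.cos_eq_one_iff_of_lt_of_lt] at h1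
  · have h2 : ((v.val : ℝ) - w.val) / n = 0 := by
      rcases mul_eq_zero.mp h1 with h3 | h3
      · linarith
      · exact h3
    rw [div_eq_zero_iff] at h2
    apply ZMod.val_injective n
    rcases h2 with h2 | h2
    · exact_mod_cast (sub_eq_zero.mp h2).symm
    · linarith
  · have : -1 < ((v.val : ℝ) - w.val) / n := by rw [lt_div_iff₀ hn]; linarith
    nlinarith
  · have : ((v.val : ℝ) - w.val) / n < 1 := by rw [div_lt_iff₀ hn]; linarith
    nlinarith

lemma inner_vtx_self (n : ℕ) (v : ZMod n) :
    (vtx n v).1 * (vtx n v).1 + (vtx n v).2 * (vtx n v).2 = 1 := by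
  simp only [vtx]
  linear_combination Real.sin_sq_add_cos_sq (2 * Real.pi * v.val / n)

/-- The open triangle `x y z` lies in the convex hull of its vertices. -/
lemma mem_convexHull_of_orient_pos {s : Set (ℝ × ℝ)} {x y z p : ℝ × ℝ} (hx : x ∈ s)
    (hy : y ∈ s) (hz : z ∈ s) (h₁ : 0 < orient p y z) (h₂ : 0 < orient x p z)
    (h₃ : 0 < orient x y p) : p ∈ convexHull ℝ s := by
  have hsum : orient p y z + orient x p z + orient x y p = orient x y z := by
    simp only [orient]; ring
  have hD : 0 < orient x y z := by linarith
  have hp : p = (orient p y z / orient x y z) • x + (orient x p z / orient x y z) • y +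
      (orient x y p / orient x y z) • z := by
    apply Prod.ext <;>
    · simp only [Prod.fst_add, Prod.snd_add, Prod.smul_fst, Prod.smul_snd, smul_eq_mul]
      field_simp
      simp only [orient]
      ring
  have h := (convex_convexHull ℝ s).sum_mem (t := Finset.univ)
    (w := ![orient p y z / orient x y z, orient x p z / orient x y z,
      orient x y p / orient x y z]) (z := ![x, y, z])
    (by
      intro k _
      fin_cases k
      · exact (div_pos h₁ hD).le
      · exact (div_pos h₂ hD).le
      · exact (div_pos h₃ hD).le)
    (by
      simp only [Fin.sum_univ_three, Matrix.cons_val]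
      rw [← add_div, ← add_div, hsum, div_self hD.ne'])
    (by
      intro k _
      apply subset_convexHull
      fin_cases k <;> assumption)
  simp only [Fin.sum_univ_three, Matrix.cons_val] at h
  rwa [hp]

/-- Near a vertex `y` of the triangle `x y z`, a ray from `y` towards a point `p` inside the angle
at `y` runs in the interior of the triangle. -/
lemma eventually_mem_interior_convexHull {s : Set (ℝ × ℝ)} {x y z p : ℝ × ℝ} (hx : x ∈ s)
    (hy : y ∈ s) (hz : z ∈ s) (hxyz : 0 < orient x y z) (hpyz : 0 < orient p y z)
    (hxyp : 0 < orient x y p) :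
    ∀ᶠ t : ℝ in 𝓝[>] 0, AffineMap.lineMap y p t ∈ interior (convexHull ℝ s) := by
  have hopen : IsOpen {q : ℝ × ℝ | 0 < orient q y z ∧ 0 < orient x q z ∧ 0 < orient x y q} := by
    simp only [orient]
    refine IsOpen.and ?_ (IsOpen.and ?_ ?_) <;>
    exact isOpen_lt (by fun_prop) (by fun_prop)
  have hsub : {q : ℝ × ℝ | 0 < orient q y z ∧ 0 < orient x q z ∧ 0 < orient x y q} ⊆
      interior (convexHull ℝ s) :=
    interior_maximal (fun q hq => mem_convexHull_of_orient_pos hx hy hz hq.1 hq.2.1 hq.2.2) hopen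
  have hlim : ∀ᶠ t : ℝ in 𝓝 0, 0 < orient x (AffineMap.lineMap y p t) z := by
    have hcont : Continuous fun t : ℝ => orient x (AffineMap.lineMap y p t) z := by
      simp only [orient, AffineMap.lineMap_apply_module]
      fun_prop
    exact hcont.continuousAt.eventually_const_lt (by simpa using hxyz)
  filter_upwards [nhdsWithin_le_nhds hlim, self_mem_nhdsWithin] with t ht ht0
  have ht0 : 0 < t := ht0
  refine hsub ⟨?_, ht, ?_⟩
  · have : orient (AffineMap.lineMap y p t) y z = t * orient p y z := by
      simp only [orient, AffineMap.lineMap_apply_module, Prod.fst_add, Prod.snd_add,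
        Prod.smul_fst, Prod.smul_snd, smul_eq_mul]
      ring
    rw [this]; positivity
  · have : orient x y (AffineMap.lineMap y p t) = t * orient x y p := by
      simp only [orient, AffineMap.lineMap_apply_module, Prod.fst_add, Prod.snd_add,
        Prod.smul_fst, Prod.smul_snd, smul_eq_mul]
      ring
    rw [this]; positivity

lemma orient_rotate (x y z : ℝ × ℝ) : orient x y z = orient y z x := by
  simp only [orient]; ring

lemma orient_swap (x y z : ℝ × ℝ) : orient x y z = -orient y x z := by
  simp only [orient]; ring

lemma orient_self_left (x z : ℝ × ℝ) : orient x x z = 0 := by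
  simp only [orient]; ring

lemma orient_midpoint (x y p q : ℝ × ℝ) :
    orient x y (midpoint ℝ p q) = (orient x y p + orient x y q) / 2 := by
  simp only [orient, midpoint_eq_smul_add, Prod.fst_add, Prod.snd_add, Prod.smul_fst,
    Prod.smul_snd, smul_eq_mul, invOf_eq_inv]
  ring

section Ends

variable {n : ℕ} [NeZero n] {a b v : ZMod n}

lemma orient_midpoint_ends_of_lt (ha : ∀ x : ZMod n, a.val ≤ x.val) (hvb : v.val < b.val)
    {u : ZMod n} (hu : u.val < v.val) :
    0 < orient (vtx n u) (vtx n v) (midpoint ℝ (vtx n a) (vtx n b)) := by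
  rw [orient_midpoint]
  have h₁ := orient_vtx_pos hu hvb
  have h₂ : 0 ≤ orient (vtx n u) (vtx n v) (vtx n a) := by
    rw [orient_rotate, orient_rotate]
    rcases (ha u).lt_or_eq with h | h
    · exact (orient_vtx_pos h hu).le
    · rw [ZMod.val_injective n h, orient_self_left]
  linarith

lemma orient_midpoint_ends_of_gt (hb : ∀ x : ZMod n, x.val ≤ b.val) (hav : a.val < v.val)
    {w : ZMod n} (hw : v.val < w.val) :
    0 < orient (vtx n v) (vtx n w) (midpoint ℝ (vtx n a) (vtx n b)) := by
  rw [orient_midpoint]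
  have h₁ : 0 < orient (vtx n v) (vtx n w) (vtx n a) := by
    rw [orient_rotate, orient_rotate]
    exact orient_vtx_pos hav hw
  have h₂ : 0 ≤ orient (vtx n v) (vtx n w) (vtx n b) := by
    rcases (hb w).lt_or_eq with h | h
    · exact (orient_vtx_pos hw h).le
    · rw [ZMod.val_injective n h, orient_rotate, orient_self_left]
  linarith

end Ends

/-- A convex hull lies in an open half-plane together with one boundary point if the
generators do. -/
lemma eq_or_orient_pos_of_mem_convexHull {s : Set (ℝ × ℝ)} {y p : ℝ × ℝ} (σ : ℝ)
    (hs : ∀ x ∈ s, x = y ∨ 0 < σ * orient y p x) {q : ℝ × ℝ} (hq : q ∈ convexHull ℝ s) :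
    q = y ∨ 0 < σ * orient y p q := by
  refine convexHull_min (t := {x | x = y ∨ 0 < σ * orient y p x}) hs ?_ hq
  rw [convex_iff_forall_pos]
  intro x hx z hz α β hα hβ hαβ
  have hcomb : orient y p (α • x + β • z) = α * orient y p x + β * orient y p z := by
    obtain rfl : β = 1 - α := by linarith
    simp only [orient, Prod.fst_add, Prod.snd_add, Prod.smul_fst, Prod.smul_snd, smul_eq_mul]
    ring
  have hy : orient y p y = 0 := by simp [orient]
  simp only [Set.mem_ofPred_eq, hcomb] at hx hz ⊢
  rcases hx with rfl | hx <;> rcases hz with rfl | hz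
  · left; rw [← add_smul, hαβ, one_smul]
  · right; rw [hy]; nlinarith [mul_pos hβ hz]
  · right; rw [hy]; nlinarith [mul_pos hα hx]
  · right; nlinarith [mul_pos hα hx, mul_pos hβ hz]

/-- A hull of polygon vertices that meets a small neighbourhood of the vertex `v` has `v` among
its generators. -/
lemma eventually_mem_of_mem_cellHull {n : ℕ} [NeZero n] (v : ZMod n) :
    ∀ᶠ x in 𝓝 (vtx n v), ∀ c : Finset (ZMod n), x ∈ cellHull n c → v ∈ c := by
  have hw : ∀ w : ZMod n, w ≠ v → ∀ᶠ x in 𝓝 (vtx n v),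
      (vtx n v).1 * (vtx n w).1 + (vtx n v).2 * (vtx n w).2 <
        (vtx n v).1 * x.1 + (vtx n v).2 * x.2 := by
    intro w hwv
    have hcont : Continuous fun x : ℝ × ℝ => (vtx n v).1 * x.1 + (vtx n v).2 * x.2 := by
      fun_prop
    refine hcont.continuousAt.eventually_const_lt ?_
    beta_reduce
    rw [inner_vtx_self]
    exact inner_vtx_lt_one hwv
  have hall : ∀ᶠ x in 𝓝 (vtx n v), ∀ w : ZMod n, w ≠ v →
      (vtx n v).1 * (vtx n w).1 + (vtx n v).2 * (vtx n w).2 <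
        (vtx n v).1 * x.1 + (vtx n v).2 * x.2 := by
    rw [eventually_all]
    intro w
    by_cases h : w = v
    · simp [h]
    · simpa [h] using hw w h
  filter_upwards [hall] with x hx c hxc
  by_contra hvc
  let f : ℝ × ℝ →ₗ[ℝ] ℝ :=
    (vtx n v).1 • LinearMap.fst ℝ ℝ ℝ + (vtx n v).2 • LinearMap.snd ℝ ℝ ℝ
  have hsub : cellHull n c ⊆ {y | f y < f x} := by
    refine convexHull_min ?_ (convex_halfSpace_lt f.isLinear _)
    rintro _ ⟨w, hwc, rfl⟩
    simpa [f] using hx w (fun h => hvc (h ▸ hwc))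
  exact lt_irrefl (f x) (hsub hxc)

lemma exists_unique_cell_innerVertices {n d : ℕ} [NeZero n] {T : Finset (Finset (ZMod n))}
    (hT : IsDAngulation n d T) {v : ZMod n} (hv : v ∈ innerVertices Finset.univ) :
    ∃! c, c ∈ T ∧ v ∈ innerVertices c := by
  obtain ⟨-, hcover, hdisj⟩ := hT
  obtain ⟨a, -, ha⟩ := Finset.univ.exists_min_image (ZMod.val (n := n)) Finset.univ_nonempty
  obtain ⟨b, -, hb⟩ := Finset.univ.exists_max_image (ZMod.val (n := n)) Finset.univ_nonempty
  replace ha := fun x => ha x (Finset.mem_univ x)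
  replace hb := fun x => hb x (Finset.mem_univ x)
  obtain ⟨-, ⟨u₀, -, hu₀⟩, w₀, -, hw₀⟩ := mem_innerVertices.mp hv
  have hav : a.val < v.val := (ha u₀).trans_lt hu₀
  have hvb : v.val < b.val := hw₀.trans_le (hb w₀)
  set p := midpoint ℝ (vtx n a) (vtx n b)
  have hlow : ∀ u : ZMod n, u.val < v.val → 0 < orient (vtx n u) (vtx n v) p :=
    fun u hu => orient_midpoint_ends_of_lt ha hvb hu
  have hhigh : ∀ w : ZMod n, v.val < w.val → 0 < orient (vtx n v) (vtx n w) p :=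
    fun w hw => orient_midpoint_ends_of_gt hb hav hw
  have hpv : p ≠ vtx n v := by
    intro h
    have := hlow a hav
    rw [h, orient_rotate, orient_self_left] at this
    exact lt_irrefl _ this
  have hmem : ∀ {c : Finset (ZMod n)} {x : ZMod n}, x ∈ c →
      vtx n x ∈ vtx n '' (c : Set (ZMod n)) :=
    fun hx => Set.mem_image_of_mem _ hx
  have hray : Tendsto (AffineMap.lineMap (vtx n v) p : ℝ → ℝ × ℝ) (𝓝[>] 0) (𝓝 (vtx n v)) := by
    have hcont : Continuous (AffineMap.lineMap (vtx n v) p : ℝ → ℝ × ℝ) :=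
      AffineMap.lineMap_continuous
    simpa using (hcont.tendsto 0).mono_left nhdsWithin_le_nhds
  have hpoly : p ∈ convexHull ℝ (Set.range (vtx n)) :=
    (convex_convexHull ℝ _).midpoint_mem (subset_convexHull ℝ _ (Set.mem_range_self a))
      (subset_convexHull ℝ _ (Set.mem_range_self b))
  apply existsUnique_of_exists_of_unique
  · obtain ⟨t, hvt, ht0, ht1⟩ := ((hray.eventually (eventually_mem_of_mem_cellHull v)).and
      (Ioo_mem_nhdsGT (zero_lt_one (α := ℝ)))).exists
    set x : ℝ × ℝ := AffineMap.lineMap (vtx n v) p t with hxdef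
    have hx : x ∈ convexHull ℝ (Set.range (vtx n)) :=
      (convex_convexHull ℝ _).lineMap_mem (subset_convexHull ℝ _ (Set.mem_range_self v)) hpoly ⟨ht0.le, ht1.le⟩
    rw [← hcover] at hx
    simp only [Set.mem_iUnion, exists_prop] at hx
    obtain ⟨c, hcT, hxc⟩ := hx
    have hxv : x ≠ vtx n v := by
      rw [hxdef, Ne, AffineMap.lineMap_eq_left_iff]
      rintro (h | h)
      · exact hpv h.symm
      · exact ht0.ne' h
    have hx0 : orient (vtx n v) p x = 0 := by
      simp only [hxdef, orient, AffineMap.lineMap_apply_module, Prod.fst_add, Prod.snd_add,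
        Prod.smul_fst, Prod.smul_snd, smul_eq_mul]
      ring
    refine ⟨c, hcT, mem_innerVertices.mpr ⟨hvt c hxc, ?_, ?_⟩⟩
    · by_contra! hall
      refine (eq_or_orient_pos_of_mem_convexHull (y := vtx n v) (p := p) (-1) ?_ hxc).elim hxv
        (by simp [hx0])
      rintro _ ⟨w, hw, rfl⟩
      rcases (hall w hw).lt_or_eq with h | h
      · right
        rw [orient_swap, orient_rotate, neg_one_mul, neg_neg]
        exact hhigh w h
      · left; rw [ZMod.val_injective n h]
    · by_contra! hall
      refine (eq_or_orient_pos_of_mem_convexHull (y := vtx n v) (p := p) 1 ?_ hxc).elim hxv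
        (by simp [hx0])
      rintro _ ⟨u, hu, rfl⟩
      rcases (hall u hu).lt_or_eq with h | h
      · right
        rw [one_mul, ← orient_rotate]
        exact hlow u h
      · left; rw [ZMod.val_injective n h]
  · rintro c c' ⟨hc, hvc⟩ ⟨hc', hvc'⟩
    have hint : ∀ c : Finset (ZMod n), v ∈ innerVertices c →
        ∀ᶠ t : ℝ in 𝓝[>] 0, AffineMap.lineMap (vtx n v) p t ∈ interior (cellHull n c) := by
      intro c hvc
      obtain ⟨hv, ⟨u, hu, huv⟩, w, hw, hvw⟩ := mem_innerVertices.mp hvc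
      refine eventually_mem_interior_convexHull (hmem hu) (hmem hv) (hmem hw)
        (orient_vtx_pos huv hvw) ?_ (hlow u huv)
      rw [orient_rotate]
      exact hhigh w hvw
    by_contra hne
    obtain ⟨t, ht, ht'⟩ := ((hint c hvc).and (hint c' hvc')).exists
    have : AffineMap.lineMap (vtx n v) p t ∈
        interior (cellHull n c) ∩ interior (cellHull n c') := ⟨ht, ht'⟩
    rw [hdisj c hc c' hc' hne] at this
    exact this

/-- A `d`-angulation of the `n`-gon has `(n - 2) / (d - 2)` cells. -/
lemma IsDAngulation.card_mul {n d : ℕ} [NeZero n] (hd : 2 ≤ d) (hn : 2 ≤ n)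
    {T : Finset (Finset (ZMod n))} (hT : IsDAngulation n d T) :
    T.card * (d - 2) = n - 2 := by
  have hcount := Finset.sum_card_bipartiteAbove_eq_sum_card_bipartiteBelow
    (s := T) (t := innerVertices (Finset.univ : Finset (ZMod n)))
    (fun c v => v ∈ innerVertices c)
  have habove : ∀ c ∈ T, (Finset.bipartiteAbove (fun c v => v ∈ innerVertices c)
      (innerVertices (Finset.univ : Finset (ZMod n))) c).card = d - 2 := by
    intro c hc
    rw [← hT.1 c hc, ← card_innerVertices c (by rw [hT.1 c hc]; exact hd)]
    congr 1
    ext v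
    simp only [Finset.mem_bipartiteAbove, mem_innerVertices, Finset.mem_univ, true_and]
    constructor
    · exact fun h => h.2
    · rintro h
      exact ⟨⟨h.2.1.imp fun _ => And.right, h.2.2.imp fun _ => And.right⟩, h⟩
  have hbelow : ∀ v ∈ innerVertices (Finset.univ : Finset (ZMod n)),
      (Finset.bipartiteBelow (fun c v => v ∈ innerVertices c) T v).card = 1 := by
    intro v hv
    rw [Finset.card_eq_one_iff_existsUnique]
    simpa [Finset.mem_bipartiteBelow] using exists_unique_cell_innerVertices hT hv
  rw [Finset.sum_congr rfl habove, Finset.sum_congr rfl hbelow] at hcount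
  simp only [Finset.sum_const, smul_eq_mul, mul_one] at hcount
  rw [hcount, card_innerVertices _ (by simpa [ZMod.card] using hn), Finset.card_univ, ZMod.card]

/-- The occurrences of the cells along a sequence add up to its length. -/
lemma sum_card_occurrences {α : Type*} [DecidableEq α] {T : Finset α} {l : ℕ}
    (q : Fin l → {c // c ∈ T}) :
    ∑ c ∈ T, (Finset.univ.filter fun k => (q k : α) = c).card = l := by
  have := Finset.card_eq_sum_card_fiberwise (s := (Finset.univ : Finset (Fin l))) (t := T)
    (f := fun k => (q k : α)) (fun k _ => (q k).2)
  simpa using this.symm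

/-- For a `d`-angulation `T` of the convex `n`-gon, `n = d + m * (d - 2)`:
`m_{i,i} = 0`, `m_{i,i+1} = 1`, and every `d`-path from `i+1` to `i` has length
`n - 2` and contains every `d`-gon of `T` exactly `d - 2` times. -/
theorem dPath_basic (d m n : ℕ) (hd : 3 ≤ d) (hn : n = d + m * (d - 2))
    (T : Finset (Finset (ZMod n))) (hT : IsDAngulation n d T) (i : ZMod n) :
    dPathCount n d T i i = 0 ∧
    dPathCount n d T i (i + 1) = 1 ∧
    pathLen n (i + 1) i = n - 2 ∧
    ∀ q : Fin (pathLen n (i + 1) i) → {c // c ∈ T}, IsDPath n d T (i + 1) i q →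
      ∀ c ∈ T,
        (Finset.univ.filter (fun k => (q k : Finset (ZMod n)) = c)).card = d - 2 := by
  have hn3 : 3 ≤ n := by omega
  have : NeZero n := ⟨by omega⟩
  have hcard := hT.card_mul (by omega) (by omega)
  have hlen : ∀ k : ℕ, 0 < k → k < n → (-(k : ZMod n)).val = n - k := by
    intro k hk hkn
    have : -(k : ZMod n) = ((n - k : ℕ) : ZMod n) := by
      rw [Nat.cast_sub hkn.le, ZMod.natCast_self, zero_sub]
    rw [this, ZMod.val_natCast_of_lt (by omega)]
  have hlast : pathLen n (i + 1) i = n - 2 := by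
    rw [← hlen 2 (by omega) (by omega), pathLen]
    congr 1
    push_cast
    ring
  refine ⟨?_, ?_, hlast, ?_⟩
  · have hii : pathLen n i i = n - 1 := by
      rw [← hlen 1 (by omega) (by omega), pathLen]
      congr 1
      push_cast
      ring
    have : IsEmpty {q : Fin (pathLen n i i) → {c // c ∈ T} // IsDPath n d T i i q} := by
      refine ⟨?_⟩
      rintro ⟨q, -, hq⟩
      have hle := Finset.sum_le_sum hq
      rw [sum_card_occurrences, Finset.sum_const, smul_eq_mul] at hle
      omega
    exact Nat.card_of_isEmpty
  · have hii : pathLen n i (i + 1) = 0 := by simp [pathLen]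
    have : IsEmpty (Fin (pathLen n i (i + 1))) := by rw [hii]; infer_instance
    rw [dPathCount, Nat.card_eq_one_iff_unique]
    refine ⟨inferInstance, ⟨⟨isEmptyElim, isEmptyElim, fun c _ => ?_⟩⟩⟩
    simp
  · intro q hq
    refine (Finset.sum_eq_sum_iff_of_le hq.2).mp ?_
    rw [sum_card_occurrences, Finset.sum_const, smul_eq_mul]
    omega
end
end
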